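/- arXiv:1612.09421 — 3 statements merged into one kernel-verified Lean document; each statement's English description precedes it below -/
import Mathlib

section
/- Let g be a metric field on an open set Ω ⊆ ℝ⁴ and define the Einstein tensor G_{αβ} := R_{αβ} − (1/2) R g_{αβ}. Then the contracted Bianchi identity holds as a pointwise identity on Ω: for every β = 0,1,2,3, h^{αλ} (∂_λ G_{αβ} − Γ^δ_{λα} G_{δβ} − Γ^δ_{λβ} G_{αδ}) = 0. -/
noncomputable section

open scoped BigOperators
open Real

/-- Points of `ℝ⁴`. -/
abbrev Pt : Type := Fin 4 → ℝ

/-- A metric field: a map from points to 4×4 real matrices. -/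
abbrev Met : Type := Pt → Matrix (Fin 4) (Fin 4) ℝ

/-- Partial derivative `∂_α u` of a scalar function on `ℝ⁴`. -/
noncomputable def pd (α : Fin 4) (u : Pt → ℝ) (x : Pt) : ℝ :=
  fderiv ℝ u x (Pi.single α 1)

/-- The pointwise inverse metric `h = g⁻¹`. -/
noncomputable def ginv (g : Met) (x : Pt) : Matrix (Fin 4) (Fin 4) ℝ := (g x)⁻¹

/-- `g` is a metric field on `Ω`: smooth, symmetric and invertible there. -/
def IsMetricOn (g : Met) (Ω : Set Pt) : Prop :=
  (∀ α β : Fin 4, ContDiffOn ℝ (⊤ : ℕ∞) (fun x => g x α β) Ω) ∧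
  (∀ x ∈ Ω, (g x).IsSymm) ∧
  (∀ x ∈ Ω, IsUnit (g x).det)

/-- Christoffel symbols `Γ^λ_{αβ}`. -/
noncomputable def Chr (g : Met) (lam α β : Fin 4) (x : Pt) : ℝ :=
  (1/2) * ∑ μ : Fin 4, ginv g x lam μ *
    (pd α (fun y => g y β μ) x + pd β (fun y => g y α μ) x - pd μ (fun y => g y α β) x)

/-- Ricci curvature `R_{αβ} = ∂_λ Γ^λ_{αβ} − ∂_α Γ^λ_{βλ} + Γ^λ_{αβ} Γ^δ_{λδ} − Γ^λ_{αδ} Γ^δ_{βλ}`. -/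
noncomputable def Ric (g : Met) (α β : Fin 4) (x : Pt) : ℝ :=
  (∑ lam : Fin 4, pd lam (Chr g lam α β) x)
  - (∑ lam : Fin 4, pd α (Chr g lam β lam) x)
  + (∑ lam : Fin 4, ∑ δ : Fin 4, Chr g lam α β x * Chr g δ lam δ x)
  - (∑ lam : Fin 4, ∑ δ : Fin 4, Chr g lam α δ x * Chr g δ β lam x)

/-- Scalar curvature `R = h^{αβ} R_{αβ}`. -/
noncomputable def Scal (g : Met) (x : Pt) : ℝ :=
  ∑ α : Fin 4, ∑ β : Fin 4, ginv g x α β * Ric g α β x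

/-- Covariant Hessian of a scalar: `∇_α∇_β u = ∂_α∂_β u − Γ^λ_{αβ} ∂_λ u`. -/
noncomputable def covHess (g : Met) (u : Pt → ℝ) (α β : Fin 4) (x : Pt) : ℝ :=
  pd α (pd β u) x - ∑ lam : Fin 4, Chr g lam α β x * pd lam u x

/-- Geometric wave operator `□_g u = h^{αβ} ∇_α∇_β u`. -/
noncomputable def boxg (g : Met) (u : Pt → ℝ) (x : Pt) : ℝ :=
  ∑ α : Fin 4, ∑ β : Fin 4, ginv g x α β * covHess g u α β x

/-- The Einstein tensor `G_{αβ} = R_{αβ} − (1/2) R g_{αβ}`. -/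
noncomputable def Ein (g : Met) (α β : Fin 4) (x : Pt) : ℝ :=
  Ric g α β x - (1/2) * Scal g x * g x α β

/-! ### Calculus of smooth scalar and matrix fields on an open set -/

theorem pd_contDiffOn {Ω : Set Pt} (hΩ : IsOpen Ω) {u : Pt → ℝ}
    (hu : ContDiffOn ℝ (⊤ : ℕ∞) u Ω) (a : Fin 4) : ContDiffOn ℝ (⊤ : ℕ∞) (pd a u) Ω := by
  have h1 : ContDiffOn ℝ (⊤ : ℕ∞) (fderiv ℝ u) Ω :=
    hu.fderiv_of_isOpen hΩ (by simp)
  exact h1.clm_apply contDiffOn_const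

theorem diffAt_of {Ω : Set Pt} (hΩ : IsOpen Ω) {u : Pt → ℝ}
    (hu : ContDiffOn ℝ (⊤ : ℕ∞) u Ω) {x : Pt} (hx : x ∈ Ω) : DifferentiableAt ℝ u x :=
  (hu.contDiffAt (hΩ.mem_nhds hx)).differentiableAt (by simp)

theorem pd_congr {Ω : Set Pt} (hΩ : IsOpen Ω) {u v : Pt → ℝ} (h : ∀ y ∈ Ω, u y = v y)
    {x : Pt} (hx : x ∈ Ω) (a : Fin 4) : pd a u x = pd a v x := by
  have : u =ᶠ[nhds x] v := by
    filter_upwards [hΩ.mem_nhds hx] with y hy using h y hy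
  simp only [pd, this.fderiv_eq]

theorem pd_comm {Ω : Set Pt} (hΩ : IsOpen Ω) {u : Pt → ℝ}
    (hu : ContDiffOn ℝ (⊤ : ℕ∞) u Ω) {x : Pt} (hx : x ∈ Ω) (a b : Fin 4) :
    pd a (pd b u) x = pd b (pd a u) x := by
  have hc : ContDiffAt ℝ (⊤ : ℕ∞) u x := hu.contDiffAt (hΩ.mem_nhds hx)
  have hs : IsSymmSndFDerivAt ℝ u x := hc.isSymmSndFDerivAt (by
    rw [minSmoothness_of_isRCLikeNormedField]
    exact WithTop.coe_le_coe.2 le_top)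
  have hd : DifferentiableAt ℝ (fderiv ℝ u) x :=
    (hc.fderiv_right (m := 1) (WithTop.coe_le_coe.2 le_top)).differentiableAt (by simp)
  have key : ∀ c d : Fin 4, pd c (pd d u) x
      = fderiv ℝ (fderiv ℝ u) x (Pi.single c 1) (Pi.single d 1) := by
    intro c d
    unfold pd
    rw [fderiv_clm_apply hd (by fun_prop)]
    simp
  rw [key, key, hs.eq]

theorem pd_add {u v : Pt → ℝ} {x : Pt} (hu : DifferentiableAt ℝ u x)
    (hv : DifferentiableAt ℝ v x) (a : Fin 4) :
    pd a (fun y => u y + v y) x = pd a u x + pd a v x := by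
  simp [pd, fderiv_fun_add hu hv]

theorem pd_sub {u v : Pt → ℝ} {x : Pt} (hu : DifferentiableAt ℝ u x)
    (hv : DifferentiableAt ℝ v x) (a : Fin 4) :
    pd a (fun y => u y - v y) x = pd a u x - pd a v x := by
  simp [pd, fderiv_fun_sub hu hv]

theorem pd_mul {u v : Pt → ℝ} {x : Pt} (hu : DifferentiableAt ℝ u x)
    (hv : DifferentiableAt ℝ v x) (a : Fin 4) :
    pd a (fun y => u y * v y) x = pd a u x * v x + u x * pd a v x := by
  simp [pd, fderiv_fun_mul hu hv]; ring

theorem pd_sum {u : Fin 4 → Pt → ℝ} {x : Pt} (hu : ∀ i, DifferentiableAt ℝ (u i) x)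
    (a : Fin 4) :
    pd a (fun y => ∑ i, u i y) x = ∑ i, pd a (u i) x := by
  simp [pd, fderiv_fun_sum (fun i _ => hu i)]

/-- Smooth matrix fields. -/
def SmM (Ω : Set Pt) (M : Met) : Prop :=
  ∀ i j, ContDiffOn ℝ (⊤ : ℕ∞) (fun x => M x i j) Ω

/-- Entrywise partial derivative of a matrix field. -/
def mpd (a : Fin 4) (M : Met) (x : Pt) : Matrix (Fin 4) (Fin 4) ℝ :=
  fun i j => pd a (fun y => M y i j) x

section calc_lemmas

variable {Ω : Set Pt} {M N : Met}

theorem SmM.add (hM : SmM Ω M) (hN : SmM Ω N) : SmM Ω (fun x => M x + N x) :=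
  fun i j => (hM i j).add (hN i j)

theorem SmM.sub (hM : SmM Ω M) (hN : SmM Ω N) : SmM Ω (fun x => M x - N x) :=
  fun i j => (hM i j).sub (hN i j)

theorem SmM.neg (hM : SmM Ω M) : SmM Ω (fun x => - M x) :=
  fun i j => (hM i j).neg

theorem SmM.tr (hM : SmM Ω M) : SmM Ω (fun x => (M x).transpose) :=
  fun i j => hM j i

theorem SmM.mul (hM : SmM Ω M) (hN : SmM Ω N) : SmM Ω (fun x => M x * N x) := by
  intro i j
  simp only [Matrix.mul_apply]
  exact ContDiffOn.sum fun k _ => (hM i k).mul (hN k j)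

theorem SmM.mpd (hM : SmM Ω M) (hΩ : IsOpen Ω) (a : Fin 4) : SmM Ω (mpd a M) :=
  fun i j => pd_contDiffOn hΩ (hM i j) a

theorem mpd_add (hΩ : IsOpen Ω) (hM : SmM Ω M) (hN : SmM Ω N) {x : Pt} (hx : x ∈ Ω)
    (a : Fin 4) : mpd a (fun x => M x + N x) x = mpd a M x + mpd a N x := by
  ext i j
  exact pd_add (diffAt_of hΩ (hM i j) hx) (diffAt_of hΩ (hN i j) hx) a

theorem mpd_sub (hΩ : IsOpen Ω) (hM : SmM Ω M) (hN : SmM Ω N) {x : Pt} (hx : x ∈ Ω)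
    (a : Fin 4) : mpd a (fun x => M x - N x) x = mpd a M x - mpd a N x := by
  ext i j
  exact pd_sub (diffAt_of hΩ (hM i j) hx) (diffAt_of hΩ (hN i j) hx) a

theorem mpd_neg (M : Met) (x : Pt) (a : Fin 4) :
    mpd a (fun x => - M x) x = - mpd a M x := by
  ext i j
  simp [mpd, pd, fderiv_fun_neg]

theorem mpd_tr (M : Met) (x : Pt) (a : Fin 4) :
    mpd a (fun x => (M x).transpose) x = (mpd a M x).transpose := rfl

theorem mpd_mul (hΩ : IsOpen Ω) (hM : SmM Ω M) (hN : SmM Ω N) {x : Pt} (hx : x ∈ Ω)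
    (a : Fin 4) : mpd a (fun x => M x * N x) x = mpd a M x * N x + M x * mpd a N x := by
  ext i j
  simp only [mpd, Matrix.mul_apply, Matrix.add_apply]
  rw [pd_sum (u := fun k y => M y i k * N y k j) (fun k => (diffAt_of hΩ (hM i k) hx).mul (diffAt_of hΩ (hN k j) hx)),
    ← Finset.sum_add_distrib]
  exact Finset.sum_congr rfl fun k _ =>
    pd_mul (diffAt_of hΩ (hM i k) hx) (diffAt_of hΩ (hN k j) hx) a

theorem mpd_congr (hΩ : IsOpen Ω) (h : ∀ y ∈ Ω, M y = N y) {x : Pt} (hx : x ∈ Ω)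
    (a : Fin 4) : mpd a M x = mpd a N x := by
  ext i j
  exact pd_congr hΩ (fun y hy => by rw [h y hy]) hx a

theorem mpd_comm (hΩ : IsOpen Ω) (hM : SmM Ω M) {x : Pt} (hx : x ∈ Ω)
    (a b : Fin 4) : mpd a (mpd b M) x = mpd b (mpd a M) x := by
  ext i j
  exact pd_comm hΩ (hM i j) hx a b

theorem det_smooth (hM : SmM Ω M) : ContDiffOn ℝ (⊤ : ℕ∞) (fun x => (M x).det) Ω := by
  simp only [Matrix.det_apply']
  exact ContDiffOn.sum fun s _ => contDiffOn_const.mul (contDiffOn_prod fun i _ => hM _ _)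

theorem SmM.ginv (hM : SmM Ω M) (hu : ∀ x ∈ Ω, IsUnit (M x).det) : SmM Ω (ginv M) := by
  intro i j
  have h1 : ContDiffOn ℝ (⊤ : ℕ∞) (fun x => (M x).adjugate i j) Ω := by
    simp only [Matrix.adjugate_apply]
    refine det_smooth (M := fun x => (M x).updateRow j (Pi.single i 1)) ?_
    intro k l
    by_cases hk : k = j
    · subst hk
      simp only [Matrix.updateRow_self]
      exact contDiffOn_const
    · simp only [Matrix.updateRow_ne hk]
      exact hM k l
  have h2 : ContDiffOn ℝ (⊤ : ℕ∞) (fun x => ((M x).det)⁻¹ * (M x).adjugate i j) Ω :=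
    ((det_smooth hM).inv fun x hx => (hu x hx).ne_zero).mul h1
  refine h2.congr fun x _ => ?_
  simp [_root_.ginv, Matrix.inv_def, Ring.inverse_eq_inv']

end calc_lemmas

/-! ### Connection matrices and curvature -/

/-- Connection matrices `(A_a)^r_s = Γ^r_{as}`. -/
def conn (g : Met) (a : Fin 4) : Met := fun x r s => Chr g r a s x

/-- Curvature matrices. -/
def curv (g : Met) (a b : Fin 4) : Met := fun x =>
  mpd a (conn g b) x - mpd b (conn g a) x + (conn g a x * conn g b x - conn g b x * conn g a x)

/-- Curvature with the second index raised. -/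
def curvUp (g : Met) (a b : Fin 4) : Met := fun x => curv g a b x * ginv g x

section geom

variable {Ω : Set Pt} {g : Met}

theorem conn_smooth (hΩ : IsOpen Ω) (hg : IsMetricOn g Ω) (a : Fin 4) : SmM Ω (conn g a) := by
  intro r s
  have hh := SmM.ginv hg.1 hg.2.2
  unfold conn Chr
  refine contDiffOn_const.mul (ContDiffOn.sum fun m _ => (hh r m).mul ?_)
  exact ((pd_contDiffOn hΩ (hg.1 _ _) _).add (pd_contDiffOn hΩ (hg.1 _ _) _)).sub
    (pd_contDiffOn hΩ (hg.1 _ _) _)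

theorem curv_smooth (hΩ : IsOpen Ω) (hg : IsMetricOn g Ω) (a b : Fin 4) : SmM Ω (curv g a b) := by
  have hA := conn_smooth hΩ hg
  exact (((hA b).mpd hΩ a).sub ((hA a).mpd hΩ b)).add
    (((hA a).mul (hA b)).sub ((hA b).mul (hA a)))

theorem curvUp_smooth (hΩ : IsOpen Ω) (hg : IsMetricOn g Ω) (a b : Fin 4) :
    SmM Ω (curvUp g a b) :=
  (curv_smooth hΩ hg a b).mul (SmM.ginv hg.1 hg.2.2)

theorem g_symm (hg : IsMetricOn g Ω) {x : Pt} (hx : x ∈ Ω) (a b : Fin 4) :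
    g x a b = g x b a := (hg.2.1 x hx).apply b a

theorem ginv_symm (hg : IsMetricOn g Ω) {x : Pt} (hx : x ∈ Ω) :
    (ginv g x).transpose = ginv g x := by
  unfold ginv
  rw [Matrix.transpose_nonsing_inv, (hg.2.1 x hx).eq]

theorem Chr_symm (hΩ : IsOpen Ω) (hg : IsMetricOn g Ω) {x : Pt} (hx : x ∈ Ω) (l a b : Fin 4) :
    Chr g l a b x = Chr g l b a x := by
  unfold Chr
  congr 1
  refine Finset.sum_congr rfl fun m _ => ?_
  rw [pd_congr hΩ (fun y hy => g_symm hg hy a b) hx m]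
  ring

theorem g_conn (hg : IsMetricOn g Ω) {x : Pt} (hx : x ∈ Ω) (a b c : Fin 4) :
    (g x * conn g a x) b c = (1/2) *
      (pd a (fun y => g y c b) x + pd c (fun y => g y a b) x - pd b (fun y => g y a c) x) := by
  have h1 : conn g a x = ginv g x * Matrix.of (fun m c => (1/2 : ℝ) *
      (pd a (fun y => g y c m) x + pd c (fun y => g y a m) x - pd m (fun y => g y a c) x)) := by
    ext r s
    simp only [conn, Chr, Matrix.mul_apply, Finset.mul_sum, Matrix.of_apply]
    exact Finset.sum_congr rfl fun m _ => by ring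
  rw [h1, ← Matrix.mul_assoc, ginv, Matrix.mul_nonsing_inv _ (hg.2.2 x hx), Matrix.one_mul,
    Matrix.of_apply]

theorem mpd_g (hΩ : IsOpen Ω) (hg : IsMetricOn g Ω) {x : Pt} (hx : x ∈ Ω) (a : Fin 4) :
    mpd a g x = (conn g a x).transpose * g x + g x * conn g a x := by
  have h1 : (conn g a x).transpose * g x = (g x * conn g a x).transpose := by
    rw [Matrix.transpose_mul, (hg.2.1 x hx).eq]
  rw [h1]
  ext b c
  rw [Matrix.add_apply, Matrix.transpose_apply, g_conn hg hx, g_conn hg hx]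
  simp only [mpd]
  rw [pd_congr hΩ (fun y hy => g_symm hg hy c b) hx a]
  ring

theorem mpd_ginv (hΩ : IsOpen Ω) (hg : IsMetricOn g Ω) {x : Pt} (hx : x ∈ Ω) (a : Fin 4) :
    mpd a (ginv g) x = -(conn g a x * ginv g x + ginv g x * (conn g a x).transpose) := by
  have hh := SmM.ginv hg.1 hg.2.2
  have h1 : mpd a (fun y => ginv g y * g y) x = 0 := by
    rw [mpd_congr hΩ (M := fun y => ginv g y * g y) (N := fun _ => 1)
      (fun y hy => Matrix.nonsing_inv_mul _ (hg.2.2 y hy)) hx a]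
    ext i j
    simp [mpd, pd]
  rw [mpd_mul hΩ hh hg.1 hx, mpd_g hΩ hg hx] at h1
  have h2 : g x * ginv g x = 1 := Matrix.mul_nonsing_inv _ (hg.2.2 x hx)
  have h3 : ginv g x * g x = 1 := Matrix.nonsing_inv_mul _ (hg.2.2 x hx)
  have h4 : mpd a (ginv g) x = mpd a (ginv g) x * (g x * ginv g x) := by
    rw [h2, Matrix.mul_one]
  have h5 : mpd a (ginv g) x * g x
      = - (ginv g x * ((conn g a x).transpose * g x + g x * conn g a x)) :=
    eq_neg_of_add_eq_zero_left h1
  rw [h4, ← Matrix.mul_assoc, h5]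
  calc _ = -((ginv g x * g x) * (conn g a x * ginv g x)
        + ginv g x * (conn g a x).transpose * (g x * ginv g x)) := by noncomm_ring
    _ = _ := by rw [h2, h3, Matrix.one_mul, Matrix.mul_one]

theorem curv_anti (g : Met) (a b : Fin 4) (x : Pt) : curv g a b x = - curv g b a x := by
  unfold curv; abel

theorem curvUp_anti (g : Met) (a b : Fin 4) (x : Pt) : curvUp g a b x = - curvUp g b a x := by
  unfold curvUp; rw [curv_anti, Matrix.neg_mul]

/-- Antisymmetry in the first pair, from metric compatibility. -/
theorem curvUp_tr (hΩ : IsOpen Ω) (hg : IsMetricOn g Ω) {x : Pt} (hx : x ∈ Ω) (a b : Fin 4) :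
    (curvUp g a b x).transpose = - curvUp g a b x := by
  have hh := SmM.ginv hg.1 hg.2.2
  have hA := conn_smooth hΩ hg
  have key : ∀ a b, mpd a (mpd b (ginv g)) x =
      -((mpd a (conn g b) x * ginv g x + conn g b x * mpd a (ginv g) x)
        + (mpd a (ginv g) x * (conn g b x).transpose
          + ginv g x * (mpd a (conn g b) x).transpose)) := by
    intro a b
    rw [mpd_congr hΩ (fun y hy => mpd_ginv hΩ hg hy b) hx a, mpd_neg,
      mpd_add hΩ ((hA b).mul hh) (hh.mul (hA b).tr) hx, mpd_mul hΩ (hA b) hh hx,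
      mpd_mul hΩ hh (hA b).tr hx, mpd_tr]
  have h := mpd_comm hΩ hh hx a b
  rw [key, key, mpd_ginv hΩ hg hx, mpd_ginv hΩ hg hx] at h
  unfold curvUp curv
  simp only [Matrix.transpose_mul, Matrix.transpose_add, Matrix.transpose_sub, ginv_symm hg hx]
  rw [← sub_eq_zero] at h ⊢
  rw [← neg_eq_zero, ← h]
  noncomm_ring

theorem bianchi (hΩ : IsOpen Ω) (hg : IsMetricOn g Ω) {x : Pt} (hx : x ∈ Ω) (a b c : Fin 4) :
    (mpd a (curvUp g b c) x + conn g a x * curvUp g b c x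
      + curvUp g b c x * (conn g a x).transpose)
    + (mpd b (curvUp g c a) x + conn g b x * curvUp g c a x
      + curvUp g c a x * (conn g b x).transpose)
    + (mpd c (curvUp g a b) x + conn g c x * curvUp g a b x
      + curvUp g a b x * (conn g c x).transpose) = 0 := by
  have hh := SmM.ginv hg.1 hg.2.2
  have hA := conn_smooth hΩ hg
  have hF := curv_smooth hΩ hg
  have hK : ∀ a b c, mpd a (curvUp g b c) x =
      mpd a (curv g b c) x * ginv g x + curv g b c x * mpd a (ginv g) x := fun a b c =>
    mpd_mul hΩ (hF b c) hh hx a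
  have hdF : ∀ a b c, mpd a (curv g b c) x =
      mpd a (mpd b (conn g c)) x - mpd a (mpd c (conn g b)) x
      + ((mpd a (conn g b) x * conn g c x + conn g b x * mpd a (conn g c) x)
        - (mpd a (conn g c) x * conn g b x + conn g c x * mpd a (conn g b) x)) := by
    intro a b c
    unfold curv
    rw [mpd_add hΩ (((hA c).mpd hΩ b).sub ((hA b).mpd hΩ c))
      (((hA b).mul (hA c)).sub ((hA c).mul (hA b))) hx,
      mpd_sub hΩ ((hA c).mpd hΩ b) ((hA b).mpd hΩ c) hx,
      mpd_sub hΩ ((hA b).mul (hA c)) ((hA c).mul (hA b)) hx,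
      mpd_mul hΩ (hA b) (hA c) hx, mpd_mul hΩ (hA c) (hA b) hx]
  simp only [hK, hdF, mpd_ginv hΩ hg hx]
  rw [mpd_comm hΩ (hA c) hx b a, mpd_comm hΩ (hA a) hx c b, mpd_comm hΩ (hA b) hx c a]
  unfold curvUp curv
  noncomm_ring

/-- Full covariant derivative of the curvature. -/
def covK (g : Met) (x : Pt) (l m n r s : Fin 4) : ℝ :=
  pd l (fun y => curvUp g m n y r s) x
    + (∑ d, Chr g r l d x * curvUp g m n x d s)
    + (∑ d, curvUp g m n x r d * Chr g s l d x)
    - (∑ d, Chr g d l m x * curvUp g d n x r s)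
    - (∑ d, Chr g d l n x * curvUp g m d x r s)

theorem covK_bianchi (hΩ : IsOpen Ω) (hg : IsMetricOn g Ω) {x : Pt} (hx : x ∈ Ω)
    (l m n r s : Fin 4) :
    covK g x l m n r s + covK g x m n l r s + covK g x n l m r s = 0 := by
  have h := congrFun (congrFun (bianchi hΩ hg hx l m n) r) s
  simp only [Matrix.add_apply, Matrix.mul_apply, Matrix.transpose_apply, mpd, conn,
    Matrix.zero_apply] at h
  have e : ∀ a b c, (∑ d, Chr g d a b x * curvUp g d c x r s)
      = - ∑ d, Chr g d b a x * curvUp g c d x r s := by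
    intro a b c
    rw [← Finset.sum_neg_distrib]
    refine Finset.sum_congr rfl fun d _ => ?_
    rw [Chr_symm hΩ hg hx d a b, curvUp_anti g d c, Matrix.neg_apply]
    ring
  unfold covK
  rw [e l m n, e m n l, e n l m]
  linarith

theorem covK_anti (g : Met) (x : Pt) (l m n r s : Fin 4) :
    covK g x l m n r s = - covK g x l n m r s := by
  have e : ∀ m n, (fun y => curvUp g m n y r s) = fun y => - curvUp g n m y r s := by
    intro m n; funext y; rw [curvUp_anti g m n]; rfl
  have e1 : ∀ y m n r s, curvUp g m n y r s = - curvUp g n m y r s := by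
    intro y m n r s; rw [curvUp_anti g m n]; rfl
  have e2 : pd l (fun y => curvUp g m n y r s) x = - pd l (fun y => curvUp g n m y r s) x := by
    rw [e m n]; simp [pd, fderiv_fun_neg]
  unfold covK
  rw [e2]
  simp only [e1 x m n, e1 x _ n, e1 x m _, mul_neg, neg_mul, Finset.sum_neg_distrib]
  ring

theorem covK_swap (hΩ : IsOpen Ω) (hg : IsMetricOn g Ω) {x : Pt} (hx : x ∈ Ω)
    (l m n r s : Fin 4) : covK g x l m n r s = - covK g x l m n s r := by
  have e1 : ∀ y ∈ Ω, ∀ m n r s, curvUp g m n y r s = - curvUp g m n y s r := by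
    intro y hy m n r s
    have := congrFun (congrFun (curvUp_tr hΩ hg hy m n) s) r
    simpa using this
  have e2 : pd l (fun y => curvUp g m n y r s) x = - pd l (fun y => curvUp g m n y s r) x := by
    rw [pd_congr hΩ (fun y hy => e1 y hy m n r s) hx l]; simp [pd, fderiv_fun_neg]
  have e3 : ∀ r s, (∑ d, Chr g r l d x * curvUp g m n x d s)
      = - ∑ d, curvUp g m n x s d * Chr g r l d x := by
    intro r s
    rw [← Finset.sum_neg_distrib]
    refine Finset.sum_congr rfl fun d _ => ?_
    rw [e1 x hx m n d s]; ring
  unfold covK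
  rw [e2, e3 r s, e3 s r]
  simp only [e1 x hx _ _ r s, mul_neg, Finset.sum_neg_distrib]
  ring

/-- Mixed Ricci tensor `P^s_n`. -/
def ricUp (g : Met) : Met := fun x s n => ∑ r, curvUp g r n x r s

theorem ricUp_smooth (hΩ : IsOpen Ω) (hg : IsMetricOn g Ω) : SmM Ω (ricUp g) :=
  fun _ _ => ContDiffOn.sum fun _ _ => curvUp_smooth hΩ hg _ _ _ _

theorem covK_trace (hΩ : IsOpen Ω) (hg : IsMetricOn g Ω) {x : Pt} (hx : x ∈ Ω)
    (l n s : Fin 4) :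
    ∑ r, covK g x l r n r s = pd l (fun y => ricUp g y s n) x
      + (∑ d, Chr g s l d x * ricUp g x d n) - ∑ d, Chr g d l n x * ricUp g x s d := by
  have hK := curvUp_smooth hΩ hg
  unfold covK ricUp
  rw [pd_sum (fun r => diffAt_of hΩ (hK r n r s) hx)]
  simp only [Finset.sum_add_distrib, Finset.sum_sub_distrib, Finset.mul_sum]
  have e1 : ∑ r, ∑ d, Chr g r l d x * curvUp g r n x d s
      = ∑ r, ∑ d, Chr g d l r x * curvUp g d n x r s := Finset.sum_comm
  have e2 : ∑ r, ∑ d, curvUp g r n x r d * Chr g s l d x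
      = ∑ d, ∑ r, Chr g s l d x * curvUp g r n x r d := by
    rw [Finset.sum_comm]; simp only [mul_comm]
  have e3 : ∑ r, ∑ d, Chr g d l n x * curvUp g r d x r s
      = ∑ d, ∑ r, Chr g d l n x * curvUp g r d x r s := Finset.sum_comm
  rw [e1, e2, e3]
  ring

/-- Contracted Bianchi identity in mixed form. -/
theorem mixed_bianchi (hΩ : IsOpen Ω) (hg : IsMetricOn g Ω) {x : Pt} (hx : x ∈ Ω) (n : Fin 4) :
    2 * ∑ s, (pd s (fun y => ricUp g y s n) x
      + (∑ d, Chr g s s d x * ricUp g x d n) - ∑ d, Chr g d s n x * ricUp g x s d)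
    = pd n (fun y => ∑ s, ricUp g y s s) x := by
  have hP := ricUp_smooth hΩ hg
  have h0 : ∑ s, ∑ r, (covK g x s r n r s + covK g x r n s r s + covK g x n s r r s) = 0 :=
    Finset.sum_eq_zero fun s _ => Finset.sum_eq_zero fun r _ => covK_bianchi hΩ hg hx _ _ _ _ _
  simp only [Finset.sum_add_distrib] at h0
  have h1 : ∑ s, ∑ r, covK g x r n s r s = ∑ s, ∑ r, covK g x s r n r s := by
    rw [Finset.sum_comm]
    refine Finset.sum_congr rfl fun s _ => Finset.sum_congr rfl fun r _ => ?_
    rw [covK_anti, covK_swap hΩ hg hx]; ring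
  have h2 : ∑ s, ∑ r, covK g x n s r r s = - ∑ s, ∑ r, covK g x n r s r s := by
    rw [← Finset.sum_neg_distrib]
    refine Finset.sum_congr rfl fun s _ => ?_
    rw [← Finset.sum_neg_distrib]
    exact Finset.sum_congr rfl fun r _ => covK_anti _ _ _ _ _ _ _
  rw [h1, h2] at h0
  simp only [covK_trace hΩ hg hx] at h0
  have h3 : ∑ s, (pd n (fun y => ricUp g y s s) x
      + (∑ d, Chr g s n d x * ricUp g x d s) - ∑ d, Chr g d n s x * ricUp g x s d)
      = pd n (fun y => ∑ s, ricUp g y s s) x := by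
    rw [pd_sum (fun s => diffAt_of hΩ (hP s s) hx), Finset.sum_sub_distrib,
      Finset.sum_add_distrib]
    have : ∑ s, ∑ d, Chr g s n d x * ricUp g x d s
      = ∑ s, ∑ d, Chr g d n s x * ricUp g x s d := Finset.sum_comm
    rw [this]; ring
  rw [h3] at h0
  linarith

theorem Ric_eq (hΩ : IsOpen Ω) (hg : IsMetricOn g Ω) {x : Pt} (hx : x ∈ Ω) (n s : Fin 4) :
    Ric g n s x = ∑ r, curv g r n x r s := by
  have c := fun l a b => Chr_symm hΩ hg hx l a b
  unfold Ric curv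
  simp only [Matrix.add_apply, Matrix.sub_apply, Matrix.mul_apply, mpd, conn,
    Finset.sum_add_distrib, Finset.sum_sub_distrib]
  have e1 : ∑ r, pd n (fun y => Chr g r r s y) x = ∑ r, pd n (Chr g r s r) x :=
    Finset.sum_congr rfl fun r _ => pd_congr hΩ (fun y hy => Chr_symm hΩ hg hy r r s) hx n
  have e2 : ∑ r, ∑ d, Chr g r r d x * Chr g d n s x
      = ∑ r, ∑ d, Chr g r n s x * Chr g d r d x := by
    rw [Finset.sum_comm]
    refine Finset.sum_congr rfl fun r _ => Finset.sum_congr rfl fun d _ => ?_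
    rw [c d d r]; ring
  have e3 : ∑ r, ∑ d, Chr g r n d x * Chr g d r s x
      = ∑ r, ∑ d, Chr g r n d x * Chr g d s r x :=
    Finset.sum_congr rfl fun r _ => Finset.sum_congr rfl fun d _ => by rw [c d r s]
  rw [e1, e2, e3]
  ring

theorem curv_trace (hΩ : IsOpen Ω) (hg : IsMetricOn g Ω) {x : Pt} (hx : x ∈ Ω) (a b : Fin 4) :
    (curv g a b x).trace = 0 := by
  have h2 : ginv g x * g x = 1 := Matrix.nonsing_inv_mul _ (hg.2.2 x hx)
  have h1 : curv g a b x = curvUp g a b x * g x := by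
    rw [curvUp, Matrix.mul_assoc, h2, Matrix.mul_one]
  have h3 : (curv g a b x).trace = - (curv g a b x).trace := by
    rw [h1]
    conv_lhs => rw [← Matrix.trace_transpose, Matrix.transpose_mul, curvUp_tr hΩ hg hx,
      (hg.2.1 x hx).eq, Matrix.trace_mul_comm, Matrix.neg_mul, Matrix.trace_neg]
  linarith

theorem Ric_symm (hΩ : IsOpen Ω) (hg : IsMetricOn g Ω) {x : Pt} (hx : x ∈ Ω) (a b : Fin 4) :
    Ric g a b x = Ric g b a x := by
  have h := curv_trace hΩ hg hx a b
  unfold curv at h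
  rw [Matrix.trace_add, Matrix.trace_sub, Matrix.trace_sub,
    Matrix.trace_mul_comm (conn g a x), sub_self, add_zero] at h
  have t : ∀ a b, (mpd a (conn g b) x).trace = ∑ r, pd a (Chr g r b r) x := fun a b => rfl
  rw [t, t] at h
  have c := fun l a b => Chr_symm hΩ hg hx l a b
  have e1 : ∑ r, pd r (Chr g r a b) x = ∑ r, pd r (Chr g r b a) x :=
    Finset.sum_congr rfl fun r _ => pd_congr hΩ (fun y hy => Chr_symm hΩ hg hy r a b) hx r
  have e3 : ∑ r, ∑ d, Chr g r a d x * Chr g d b r x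
      = ∑ r, ∑ d, Chr g r b d x * Chr g d a r x := by
    rw [Finset.sum_comm]; simp only [mul_comm]
  unfold Ric
  rw [e1, e3]
  simp only [c _ a b]
  linarith

theorem ricUp_eq (hΩ : IsOpen Ω) (hg : IsMetricOn g Ω) {x : Pt} (hx : x ∈ Ω) (s n : Fin 4) :
    ricUp g x s n = ∑ a, ginv g x s a * Ric g a n x := by
  unfold ricUp curvUp
  simp only [Matrix.mul_apply]
  rw [Finset.sum_comm]
  refine Finset.sum_congr rfl fun a _ => ?_
  rw [Ric_symm hΩ hg hx a n, Ric_eq hΩ hg hx n a, Finset.mul_sum]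
  refine Finset.sum_congr rfl fun r _ => ?_
  have : ginv g x a s = ginv g x s a := congrFun (congrFun (ginv_symm hg hx) s) a
  rw [this]; ring

theorem Scal_eq (hΩ : IsOpen Ω) (hg : IsMetricOn g Ω) {x : Pt} (hx : x ∈ Ω) :
    Scal g x = ∑ s, ricUp g x s s := by
  simp only [ricUp_eq hΩ hg hx]
  unfold Scal
  refine Finset.sum_congr rfl fun a _ => Finset.sum_congr rfl fun b _ => ?_
  rw [Ric_symm hΩ hg hx]

/-- The Einstein tensor as a matrix field. -/
def einM (g : Met) : Met := fun x a b => Ein g a b x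

theorem Ric_smooth (hΩ : IsOpen Ω) (hg : IsMetricOn g Ω) (a b : Fin 4) :
    ContDiffOn ℝ (⊤ : ℕ∞) (Ric g a b) Ω := by
  refine ContDiffOn.congr (f := fun x => ∑ r, curv g r a x r b) ?_
    fun x hx => Ric_eq hΩ hg hx a b
  exact ContDiffOn.sum fun r _ => curv_smooth hΩ hg _ _ _ _

theorem Scal_smooth (hΩ : IsOpen Ω) (hg : IsMetricOn g Ω) :
    ContDiffOn ℝ (⊤ : ℕ∞) (Scal g) Ω := by
  refine ContDiffOn.congr (f := fun x => ∑ s, ricUp g x s s) ?_ fun x hx => Scal_eq hΩ hg hx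
  exact ContDiffOn.sum fun r _ => ricUp_smooth hΩ hg _ _

theorem einM_smooth (hΩ : IsOpen Ω) (hg : IsMetricOn g Ω) : SmM Ω (einM g) := fun a b =>
  (Ric_smooth hΩ hg a b).sub ((contDiffOn_const.mul (Scal_smooth hΩ hg)).mul (hg.1 a b))

theorem ginv_einM (hΩ : IsOpen Ω) (hg : IsMetricOn g Ω) {x : Pt} (hx : x ∈ Ω) (s n : Fin 4) :
    (ginv g x * einM g x) s n
      = ricUp g x s n - (1/2) * Scal g x * (1 : Matrix (Fin 4) (Fin 4) ℝ) s n := by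
  have h3 : ginv g x * g x = 1 := Matrix.nonsing_inv_mul _ (hg.2.2 x hx)
  rw [← h3, ricUp_eq hΩ hg hx]
  simp only [Matrix.mul_apply, einM, Ein, Finset.mul_sum]
  rw [← Finset.sum_sub_distrib]
  exact Finset.sum_congr rfl fun a _ => by ring

theorem raise_cov (hΩ : IsOpen Ω) (hg : IsMetricOn g Ω) {x : Pt} (hx : x ∈ Ω) (l : Fin 4) :
    ginv g x * (mpd l (einM g) x - (conn g l x).transpose * einM g x - einM g x * conn g l x)
      = mpd l (fun y => ginv g y * einM g y) x + conn g l x * (ginv g x * einM g x)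
        - (ginv g x * einM g x) * conn g l x := by
  rw [mpd_mul hΩ (SmM.ginv hg.1 hg.2.2) (einM_smooth hΩ hg) hx, mpd_ginv hΩ hg hx]
  noncomm_ring

end geom

/-- **contracted Bianchi identity.** For a metric field `g` on an open set
`Ω ⊆ ℝ⁴`, for every `β`:
`h^{αλ} (∂_λ G_{αβ} − Γ^δ_{λα} G_{δβ} − Γ^δ_{λβ} G_{αδ}) = 0` pointwise on `Ω`. -/
theorem contracted_bianchi_identity
    (Ω : Set Pt) (hΩ : IsOpen Ω) (g : Met) (hg : IsMetricOn g Ω) :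
    ∀ x ∈ Ω, ∀ β : Fin 4,
      ∑ α : Fin 4, ∑ lam : Fin 4, ginv g x α lam *
        (pd lam (fun y => Ein g α β y) x
          - (∑ δ : Fin 4, Chr g δ lam α x * Ein g δ β x)
          - (∑ δ : Fin 4, Chr g δ lam β x * Ein g α δ x)) = 0 := by
  intro x hx β
  have hP := ricUp_smooth hΩ hg
  have hS := Scal_smooth hΩ hg
  have key : ∀ l : Fin 4, ∑ α, ginv g x α l *
        (pd l (fun y => Ein g α β y) x
          - (∑ δ : Fin 4, Chr g δ l α x * Ein g δ β x)
          - (∑ δ : Fin 4, Chr g δ l β x * Ein g α δ x))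
      = (pd l (fun y => ricUp g y l β) x
      + (∑ d, Chr g l l d x * ricUp g x d β) - ∑ d, Chr g d l β x * ricUp g x l d)
      - (1/2) * (pd l (Scal g) x * (1 : Matrix (Fin 4) (Fin 4) ℝ) l β) := by
    intro l
    have h := congrFun (congrFun (raise_cov hΩ hg hx l) l) β
    have e0 : mpd l (fun y => ginv g y * einM g y) x l β
        = pd l (fun y => ricUp g y l β) x
          - (1/2) * (pd l (Scal g) x * (1 : Matrix (Fin 4) (Fin 4) ℝ) l β) := by
      have d1 := diffAt_of hΩ hS hx
      have d2 := diffAt_of hΩ (hP l β) hx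
      unfold mpd
      rw [pd_congr hΩ (fun y hy => ginv_einM hΩ hg hy l β) hx l,
        pd_sub d2 ((d1.const_mul _).mul_const _),
        pd_mul (d1.const_mul _) (by fun_prop), pd_mul (by fun_prop) d1]
      simp [pd]
      ring
    have e1 : (conn g l x * (ginv g x * einM g x)) l β
        = (∑ d, Chr g l l d x * ricUp g x d β) - (1/2) * Scal g x * Chr g l l β x := by
      rw [Matrix.mul_apply]
      simp only [ginv_einM hΩ hg hx, conn, mul_sub, Finset.sum_sub_distrib, Matrix.one_apply]
      simp
      ring
    have e2 : ((ginv g x * einM g x) * conn g l x) l β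
        = (∑ d, Chr g d l β x * ricUp g x l d) - (1/2) * Scal g x * Chr g l l β x := by
      rw [Matrix.mul_apply]
      simp only [ginv_einM hΩ hg hx, conn, sub_mul, Finset.sum_sub_distrib, Matrix.one_apply]
      simp [mul_comm]
    rw [Matrix.sub_apply, Matrix.add_apply, e0, e1, e2, Matrix.mul_apply] at h
    calc _ = _ := Finset.sum_congr rfl fun α _ => ?_
      _ = _ := h
      _ = _ := by ring
    have hs : ginv g x α l = ginv g x l α := congrFun (congrFun (ginv_symm hg hx) l) α
    rw [hs]
    simp only [Matrix.sub_apply, Matrix.mul_apply, Matrix.transpose_apply, mpd, conn, einM,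
      mul_comm (Ein g α _ x)]
  rw [Finset.sum_comm, Finset.sum_congr rfl fun l _ => key l, Finset.sum_sub_distrib]
  have h := mixed_bianchi hΩ hg hx β
  rw [pd_congr hΩ (fun y hy => (Scal_eq hΩ hg hy).symm) hx β] at h
  have e : ∑ l, (1/2) * (pd l (Scal g) x * (1 : Matrix (Fin 4) (Fin 4) ℝ) l β)
      = (1/2) * pd β (Scal g) x := by
    simp [Matrix.one_apply]
  rw [e]
  linarith
end
end

section
/- There is a universal constant C > 0 with the following property (Sobolev inequality on hyperboloids). Let u : ℝ⁴ → ℝ be smooth with support contained in the cone K := {(t, x) : |x| ≤ t − 1}. Then for every s > 1 and every point (t, x) ∈ H_s (so t = √(s² + |x|²)): |u(t, x)| ≤ C t^{−3/2} Σ_{J} ( ∫_{ℝ³} |(L^J u)(√(s² + |y|²), y)|² dy )^{1/2}, where the sum ranges over all products L^J = L_{a₁} ⋯ L_{a_k} of at most two Lorentz boosts (0 ≤ k ≤ 2, a_i ∈ {1,2,3}). -/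
noncomputable section

open scoped BigOperators RealInnerProductSpace
open MeasureTheory

/-- Spatial slice `ℝ³` with the Euclidean norm. -/
abbrev Sp : Type := EuclideanSpace ℝ (Fin 3)

/-- Spacetime `ℝ × ℝ³`, points written `(t, x)`. -/
abbrev Spt : Type := ℝ × Sp

/-- For `s > 0`, the hyperboloid `H_s = {(t, x) : t > 0, t² − |x|² = s²}`. -/
def Hyp (s : ℝ) : Set Spt := {p : Spt | 0 < p.1 ∧ p.1 ^ 2 - ‖p.2‖ ^ 2 = s ^ 2}

/-- The interior of the future light cone, `{(t, x) : t > |x|}`. -/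
def futureCone : Set Spt := {p : Spt | ‖p.2‖ < p.1}

/-- Time derivative `∂_t u` of a function on spacetime. -/
noncomputable def dt (u : Spt → ℝ) (p : Spt) : ℝ :=
  fderiv ℝ u p (1, 0)

/-- Spatial derivative `∂_a u` (`a = 1, 2, 3`) of a function on spacetime. -/
noncomputable def dx (a : Fin 3) (u : Spt → ℝ) (p : Spt) : ℝ :=
  fderiv ℝ u p (0, EuclideanSpace.single a 1)

/-- The Lorentz boost `L_a u = x^a ∂_t u + t ∂_a u`. -/
noncomputable def Lb (a : Fin 3) (u : Spt → ℝ) (p : Spt) : ℝ :=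
  p.2 a * dt u p + p.1 * dx a u p

/-- The `L²` norm of `v` on the hyperboloid `H_s`, computed by restricting to
`t = √(s² + |y|²)` and integrating over `y ∈ ℝ³`. -/
noncomputable def l2Hyp (v : Spt → ℝ) (s : ℝ) : ℝ :=
  (∫ y : Sp, (v (Real.sqrt (s ^ 2 + ‖y‖ ^ 2), y)) ^ 2) ^ ((1 : ℝ) / 2)


lemma polar_lintegral (f : Sp → ENNReal) (hf : Measurable f) :
    ∫⁻ z : Sp, f z = ∫⁻ w : Metric.sphere (0 : Sp) 1,
      (∫⁻ r in Set.Ioi (0:ℝ), ENNReal.ofReal (r ^ 2) * f (r • (w : Sp)))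
        ∂((volume : Measure Sp).toSphere) := by
  have hd : Module.finrank ℝ Sp = 3 := by simp
  have h1 := ((volume : Measure Sp).measurePreserving_homeomorphUnitSphereProd)
  rw [hd] at h1
  calc ∫⁻ z : Sp, f z
      = ∫⁻ z : ({(0 : Sp)}ᶜ : Set Sp), f z ∂((volume : Measure Sp).comap (↑)) := by
        rw [lintegral_subtype_comap (measurableSet_singleton _).compl f,
          restrict_compl_singleton]
    _ = ∫⁻ q : Metric.sphere (0 : Sp) 1 × Set.Ioi (0:ℝ), f ((q.2 : ℝ) • (q.1 : Sp))
          ∂((volume : Measure Sp).toSphere.prod (Measure.volumeIoiPow (3 - 1))) := by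
        rw [← h1.lintegral_comp_emb (Homeomorph.measurableEmbedding _)]
        refine lintegral_congr fun z => ?_
        congr 1
        have hz : ‖(z : Sp)‖ ≠ 0 := by
          exact norm_ne_zero_iff.2 (fun h => z.2 h)
        simp [smul_smul, hz]
    _ = _ := by
        rw [lintegral_prod]
        · refine lintegral_congr fun w => ?_
          simp only [Measure.volumeIoiPow]
          rw [lintegral_withDensity_eq_lintegral_mul _ (by fun_prop) (by fun_prop)]
          rw [← lintegral_subtype_comap measurableSet_Ioi]
          rfl
        · fun_prop

lemma polar_bound (G : Sp → ℝ) (hG : Continuous G) (h0 : ∀ z, 0 ≤ G z) (hi : Integrable G)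
    (c : ℝ) (hc : ∀ w : Sp, ‖w‖ = 1 → c ≤ ∫ r in (0:ℝ)..1, r ^ 2 * G (r • w)) :
    c * (volume : Measure Sp).toSphere.real Set.univ ≤ ∫ z, G z := by
  rcases lt_or_ge c 0 with hc0 | hc0
  · exact (mul_nonpos_of_nonpos_of_nonneg hc0.le measureReal_nonneg).trans (integral_nonneg h0)
  have key : ENNReal.ofReal c * (volume : Measure Sp).toSphere Set.univ
      ≤ ENNReal.ofReal (∫ z, G z) := by
    rw [ofReal_integral_eq_lintegral_ofReal hi (Filter.Eventually.of_forall h0),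
      polar_lintegral _ (by fun_prop), ← lintegral_const]
    refine lintegral_mono fun w => ?_
    have hw : ‖(w : Sp)‖ = 1 := by simp
    refine (ENNReal.ofReal_le_ofReal (hc w hw)).trans ?_
    rw [intervalIntegral.integral_of_le zero_le_one, ofReal_integral_eq_lintegral_ofReal]
    · refine (lintegral_mono_set Set.Ioc_subset_Ioi_self).trans ?_
      refine lintegral_mono fun r => ?_
      simp only []
      rw [ENNReal.ofReal_mul (by positivity)]
    · exact (Continuous.integrableOn_Icc (by fun_prop)).mono_set Set.Ioc_subset_Icc_self
    · exact Filter.Eventually.of_forall fun r => mul_nonneg (sq_nonneg r) (h0 _)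
  have := ENNReal.toReal_mono ENNReal.ofReal_ne_top key
  rwa [ENNReal.toReal_mul, ENNReal.toReal_ofReal hc0, ENNReal.toReal_ofReal (integral_nonneg h0)]
    at this

lemma one_dim (h h1 h2 : ℝ → ℝ) (H1 : ∀ r, HasDerivAt h (h1 r) r)
    (H2 : ∀ r, HasDerivAt h1 (h2 r) r) (H3 : Continuous h2) (B : ℝ → ℝ) (hB : Continuous B)
    (hle : ∀ r ∈ Set.Icc (0:ℝ) 1, (2 * |h r| + 4 * |h1 r| + |h2 r|) ^ 2 ≤ B r) :
    h 0 ^ 2 ≤ ∫ r in (0:ℝ)..1, r ^ 2 * B r := by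
  have c0 : Continuous h := continuous_iff_continuousAt.2 fun r => (H1 r).continuousAt
  have c1 : Continuous h1 := continuous_iff_continuousAt.2 fun r => (H2 r).continuousAt
  set k : ℝ → ℝ := fun r => 2 * h r - 4 * (1 - r) * h1 r + (1 - r) ^ 2 * h2 r with hk
  have ck : Continuous k := by fun_prop
  have e1 : ∫ r in (0:ℝ)..1, r * k r = h 0 := by
    rw [intervalIntegral.integral_eq_sub_of_hasDerivAt
      (f := fun r => r * (-2 * (1 - r) * h r + (1 - r) ^ 2 * h1 r) - (1 - r) ^ 2 * h r)]
    · simp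
    · intro r _
      have i1 : HasDerivAt (fun r : ℝ => r) 1 r := hasDerivAt_id r
      have i2 : HasDerivAt (fun r : ℝ => 1 - r) (-1) r := by simpa using i1.const_sub 1
      have := (i1.mul (((i2.const_mul (-2)).mul (H1 r)).add ((i2.pow 2).mul (H2 r)))).sub
        ((i2.pow 2).mul (H1 r))
      refine this.congr_deriv ?_
      simp [hk, -mul_eq_mul_left_iff]
      ring
    · exact (by fun_prop : Continuous fun r => r * k r).intervalIntegrable _ _
  have e2 : h 0 ^ 2 ≤ ∫ r in (0:ℝ)..1, (r * k r) ^ 2 := by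
    have : 0 ≤ ∫ r in (0:ℝ)..1, ((r * k r) ^ 2 - 2 * h 0 * (r * k r) + h 0 ^ 2) :=
      intervalIntegral.integral_nonneg zero_le_one fun r _ => by
        nlinarith [sq_nonneg (r * k r - h 0)]
    rw [intervalIntegral.integral_add, intervalIntegral.integral_sub,
      intervalIntegral.integral_const_mul, e1] at this
    · simp at this
      nlinarith
    all_goals exact Continuous.intervalIntegrable (by fun_prop) _ _
  refine e2.trans ?_
  refine intervalIntegral.integral_mono_on zero_le_one
    (Continuous.intervalIntegrable (by fun_prop) _ _)
    (Continuous.intervalIntegrable (by fun_prop) _ _) fun r hr => ?_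
  rw [mul_pow]
  refine mul_le_mul_of_nonneg_left ((sq_le_sq.2 ?_).trans (hle r hr)) (sq_nonneg r)
  rw [abs_of_nonneg (by positivity : 0 ≤ 2 * |h r| + 4 * |h1 r| + |h2 r|)]
  have q0 : 0 ≤ 1 - r := by linarith [hr.2]
  have q1 : 1 - r ≤ 1 := by linarith [hr.1]
  have a2 : |4 * (1 - r) * h1 r| ≤ 4 * |h1 r| := by
    rw [abs_mul, abs_of_nonneg (by positivity)]
    nlinarith [abs_nonneg (h1 r)]
  have a3 : |(1 - r) ^ 2 * h2 r| ≤ |h2 r| := by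
    rw [abs_mul, abs_of_nonneg (by positivity)]
    exact mul_le_of_le_one_left (abs_nonneg _) (pow_le_one₀ q0 q1)
  have a1 : |2 * h r| = 2 * |h r| := by simp [abs_mul]
  calc |k r| ≤ |2 * h r - 4 * (1 - r) * h1 r| + |(1 - r) ^ 2 * h2 r| := abs_add_le _ _
    _ ≤ |2 * h r| + |4 * (1 - r) * h1 r| + |(1 - r) ^ 2 * h2 r| := by
      gcongr; exact abs_sub _ _
    _ ≤ _ := by rw [a1]; gcongr

def Th (s : ℝ) (y : Sp) : ℝ := Real.sqrt (s ^ 2 + ‖y‖ ^ 2)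

lemma Th_pos {s : ℝ} (hs : 1 < s) (y : Sp) : 0 < Th s y := by
  unfold Th; positivity

lemma Th_sq (s : ℝ) (y : Sp) : Th s y ^ 2 = s ^ 2 + ‖y‖ ^ 2 := by
  unfold Th; rw [Real.sq_sqrt (by positivity)]

lemma Th_cont (s : ℝ) : Continuous (Th s) := by
  unfold Th; fun_prop

lemma norm_le_Th {s : ℝ} (hs : 1 < s) (y : Sp) : ‖y‖ ≤ Th s y := by
  refine abs_le_of_sq_le_sq' ?_ (Th_pos hs y).le |>.2
  rw [Th_sq]; nlinarith

lemma Th_lip {s : ℝ} (hs : 1 < s) (x e : Sp) : Th s x ≤ Th s (x + e) + ‖e‖ := by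
  have h1 := Th_pos hs (x + e)
  refine abs_le_of_sq_le_sq' ?_ (by positivity) |>.2
  have h2 : ‖x‖ ≤ ‖x + e‖ + ‖e‖ := by
    have := norm_sub_le (x + e) e
    simpa using this
  have h3 := norm_le_Th hs (x + e)
  have h4 : ‖x‖ ^ 2 ≤ (‖x + e‖ + ‖e‖) ^ 2 := by gcongr
  have h5 : ‖x + e‖ * ‖e‖ ≤ Th s (x + e) * ‖e‖ := by gcongr
  nlinarith [Th_sq s x, Th_sq s (x + e)]

lemma Lb_contDiff (a : Fin 3) {u : Spt → ℝ} (hu : ContDiff ℝ (⊤ : ℕ∞) u) :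
    ContDiff ℝ (⊤ : ℕ∞) (Lb a u) := by
  have h1 : ContDiff ℝ (⊤ : ℕ∞) (fderiv ℝ u) := hu.fderiv_right (by simp)
  have h2 : ContDiff ℝ (⊤ : ℕ∞) (fun p : Spt => p.2 a) := by fun_prop
  unfold Lb dt dx
  fun_prop

lemma Lb_supp (a : Fin 3) {u : Spt → ℝ} (hu : ∀ p : Spt, u p ≠ 0 → ‖p.2‖ ≤ p.1 - 1) :
    ∀ p : Spt, Lb a u p ≠ 0 → ‖p.2‖ ≤ p.1 - 1 := by
  intro p
  contrapose!
  intro hp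
  have ho : IsOpen {q : Spt | q.1 - 1 < ‖q.2‖} := isOpen_lt (by fun_prop) (by fun_prop)
  have he : u =ᶠ[nhds p] fun _ => 0 := by
    filter_upwards [ho.mem_nhds hp] with q hq
    by_contra h
    exact absurd (hu q h) (not_le.2 hq)
  have : fderiv ℝ u p = 0 := by rw [he.fderiv_eq]; simp
  simp [Lb, dt, dx, this]

lemma Th_deriv {s : ℝ} (hs : 1 < s) (x e : Sp) (r : ℝ) :
    HasDerivAt (fun r : ℝ => Th s (x + r • e)) (⟪x + r • e, e⟫ / Th s (x + r • e)) r := by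
  have h1 : HasDerivAt (fun r : ℝ => x + r • e) e r := by
    simpa using ((hasDerivAt_id r).smul_const e).const_add x
  have h2 := (h1.norm_sq.const_add (s ^ 2)).sqrt (by positivity)
  refine h2.congr_deriv ?_
  rw [mul_div_mul_left _ _ two_ne_zero]
  rfl

lemma line_deriv {s : ℝ} (hs : 1 < s) {v : Spt → ℝ} (hv : ContDiff ℝ (⊤ : ℕ∞) v) (x e : Sp)
    (r : ℝ) :
    HasDerivAt (fun r : ℝ => v (Th s (x + r • e), x + r • e))
      ((∑ a, e a * Lb a v (Th s (x + r • e), x + r • e)) / Th s (x + r • e)) r := by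
  have h1 : HasDerivAt (fun r : ℝ => x + r • e) e r := by
    simpa using ((hasDerivAt_id r).smul_const e).const_add x
  have h2 := Th_deriv hs x e r
  have h3 := ((hv.differentiable (by simp)) (Th s (x + r • e), x + r • e)).hasFDerivAt
  have h4 := h3.comp_hasDerivAt r (h2.prodMk h1)
  refine h4.congr_deriv ?_
  have hT := (Th_pos hs (x + r • e)).ne'
  generalize Th s (x + r • e) = T at hT ⊢
  generalize x + r • e = y
  have he : ((⟪y, e⟫ / T, e) : Spt) = (⟪y, e⟫ / T) • ((1, 0) : Spt)
      + ∑ a, e a • ((0, EuclideanSpace.single a 1) : Spt) := by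
    refine Prod.ext ?_ ?_
    · simp [Fin.sum_univ_three]
    · ext i
      fin_cases i <;> simp [Fin.sum_univ_three]
  rw [he, map_add, map_smul, map_sum]
  simp only [map_smul, Lb, dt, dx, smul_eq_mul]
  have hin : ⟪y, e⟫ = ∑ a, e a * y a := by
    simp [PiLp.inner_apply]
  rw [hin]
  simp only [Fin.sum_univ_three]
  field_simp
  ring

lemma quot_bound (e A : Fin 3 → ℝ) (T : ℝ) (hT : 0 < T) (he : ∀ a, |e a| ≤ T) :
    |∑ a, e a * A a| ≤ T * ∑ a, |A a| := by
  rw [Finset.mul_sum]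
  refine (Finset.abs_sum_le_sum_abs _ _).trans (Finset.sum_le_sum fun a _ => ?_)
  rw [abs_mul]
  exact mul_le_mul_of_nonneg_right (he a) (abs_nonneg _)

lemma quot_bound' (e A : Fin 3 → ℝ) (T : ℝ) (hT : 0 < T) (he : ∀ a, |e a| ≤ T) :
    |(∑ a, e a * A a) / T| ≤ ∑ a, |A a| := by
  rw [abs_div, abs_of_pos hT, div_le_iff₀ hT, mul_comm _ T]
  exact quot_bound e A T hT he

lemma alg_bound (e A : Fin 3 → ℝ) (M : Fin 3 → Fin 3 → ℝ) (h T I : ℝ) (hT : 0 < T)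
    (he : ∀ a, |e a| ≤ T) (hI : |I| ≤ T * T) :
    (2 * |h| + 4 * |(∑ a, e a * A a) / T|
      + |((∑ a, e a * ((∑ b, e b * M a b) / T)) * T - (∑ a, e a * A a) * (I / T)) / T ^ 2|) ^ 2
      ≤ 225 * (h ^ 2 + ∑ a, A a ^ 2 + ∑ a, ∑ b, M a b ^ 2) := by
  have b1 := quot_bound' e A T hT he
  have b0 := quot_bound e A T hT he
  set SA := ∑ a, |A a| with hSA
  set SM := ∑ a, ∑ b, |M a b| with hSM
  have SA0 : 0 ≤ SA := Finset.sum_nonneg fun _ _ => abs_nonneg _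
  have SM0 : 0 ≤ SM := Finset.sum_nonneg fun _ _ => Finset.sum_nonneg fun _ _ => abs_nonneg _
  have b2 : |(∑ a, e a * ((∑ b, e b * M a b) / T))| ≤ T * SM := by
    refine (quot_bound e _ T hT he).trans ?_
    refine mul_le_mul_of_nonneg_left (Finset.sum_le_sum fun a _ => ?_) hT.le
    exact quot_bound' e (M a) T hT he
  have b3 : |I / T| ≤ T := by
    rw [abs_div, abs_of_pos hT, div_le_iff₀ hT]; exact hI
  have b4 : |((∑ a, e a * ((∑ b, e b * M a b) / T)) * T - (∑ a, e a * A a) * (I / T)) / T ^ 2|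
      ≤ SM + SA := by
    rw [abs_div, abs_of_pos (by positivity : 0 < T ^ 2), div_le_iff₀ (by positivity)]
    refine (abs_sub _ _).trans ?_
    rw [abs_mul, abs_mul, abs_of_pos hT]
    have c1 := mul_le_mul_of_nonneg_right b2 hT.le
    have c2 := mul_le_mul b0 b3 (abs_nonneg _) (by positivity)
    nlinarith
  have q1 : SA ^ 2 ≤ 3 * ∑ a, A a ^ 2 := by
    have := sq_sum_le_card_mul_sum_sq (s := Finset.univ) (f := fun a : Fin 3 => |A a|)
    simpa using this
  have q2 : SM ^ 2 ≤ 9 * ∑ a, ∑ b, M a b ^ 2 := by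
    have := sq_sum_le_card_mul_sum_sq (s := Finset.univ) (f := fun a : Fin 3 => ∑ b, |M a b|)
    refine this.trans ?_
    rw [Finset.mul_sum, Finset.mul_sum]
    refine Finset.sum_le_sum fun a _ => ?_
    have := sq_sum_le_card_mul_sum_sq (s := Finset.univ) (f := fun b : Fin 3 => |M a b|)
    simp at this ⊢
    linarith
  have q3 : 0 ≤ ∑ a, A a ^ 2 := Finset.sum_nonneg fun _ _ => sq_nonneg _
  have q4 : 0 ≤ ∑ a, ∑ b, M a b ^ 2 :=
    Finset.sum_nonneg fun _ _ => Finset.sum_nonneg fun _ _ => sq_nonneg _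
  calc _ ≤ (2 * |h| + 4 * SA + (SM + SA)) ^ 2 := by gcongr
    _ ≤ 3 * (4 * |h| ^ 2 + 25 * SA ^ 2 + SM ^ 2) := by
      nlinarith [sq_nonneg (2 * |h| - 5 * SA), sq_nonneg (2 * |h| - SM), sq_nonneg (5 * SA - SM)]
    _ ≤ _ := by rw [sq_abs]; nlinarith [sq_nonneg h]

def Fd (u : Spt → ℝ) (s : ℝ) (y : Sp) : ℝ :=
  u (Th s y, y) ^ 2 + ∑ a, Lb a u (Th s y, y) ^ 2 + ∑ a, ∑ b, Lb b (Lb a u) (Th s y, y) ^ 2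

lemma rest_cont {v : Spt → ℝ} (hv : ContDiff ℝ (⊤ : ℕ∞) v) (s : ℝ) :
    Continuous fun y : Sp => v (Th s y, y) :=
  hv.continuous.comp ((Th_cont s).prodMk continuous_id)

lemma rest_int {v : Spt → ℝ} (hv : ContDiff ℝ (⊤ : ℕ∞) v)
    (hs : ∀ p : Spt, v p ≠ 0 → ‖p.2‖ ≤ p.1 - 1) (s : ℝ) :
    Integrable fun y : Sp => v (Th s y, y) ^ 2 := by
  refine ((rest_cont hv s).pow 2).integrable_of_hasCompactSupport ?_
  refine HasCompactSupport.intro (isCompact_closedBall (0 : Sp) (s ^ 2 + 1)) fun y hy => ?_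
  by_contra h
  have h1 := hs (Th s y, y) (fun h' => h (by simp [h']))
  simp only at h1
  apply hy
  rw [mem_closedBall_zero_iff]
  have h2 := Th_sq s y
  nlinarith [norm_nonneg y]

lemma Fd_cont {u : Spt → ℝ} (hu : ContDiff ℝ (⊤ : ℕ∞) u) (s : ℝ) : Continuous (Fd u s) := by
  unfold Fd
  have h0 := rest_cont hu s
  have h1 := fun a => rest_cont (Lb_contDiff a hu) s
  have h2 := fun a b => rest_cont (Lb_contDiff b (Lb_contDiff a hu)) s
  exact ((h0.pow 2).add (continuous_finsetSum _ fun a _ => (h1 a).pow 2)).add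
    (continuous_finsetSum _ fun a _ => continuous_finsetSum _ fun b _ => (h2 a b).pow 2)

lemma l2_sq (v : Spt → ℝ) (s : ℝ) : ∫ y : Sp, v (Th s y, y) ^ 2 = l2Hyp v s ^ 2 := by
  unfold l2Hyp
  rw [← Real.sqrt_eq_rpow, Real.sq_sqrt (integral_nonneg fun _ => sq_nonneg _)]
  rfl

lemma l2_nonneg (v : Spt → ℝ) (s : ℝ) : 0 ≤ l2Hyp v s := by
  unfold l2Hyp
  rw [← Real.sqrt_eq_rpow]
  exact Real.sqrt_nonneg _

lemma Fd_int {u : Spt → ℝ} (hu : ContDiff ℝ (⊤ : ℕ∞) u)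
    (hs : ∀ p : Spt, u p ≠ 0 → ‖p.2‖ ≤ p.1 - 1) (s : ℝ) :
    Integrable (Fd u s) ∧ ∫ y, Fd u s y = l2Hyp u s ^ 2 + ∑ a, l2Hyp (Lb a u) s ^ 2
      + ∑ a, ∑ b, l2Hyp (Lb b (Lb a u)) s ^ 2 := by
  have i0 := rest_int hu hs s
  have i1 := fun a => rest_int (Lb_contDiff a hu) (Lb_supp a hs) s
  have i2 := fun a b => rest_int (Lb_contDiff b (Lb_contDiff a hu)) (Lb_supp b (Lb_supp a hs)) s
  have j1 := integrable_finsetSum Finset.univ fun a _ => i1 a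
  have j2 := fun a => integrable_finsetSum Finset.univ fun b _ => i2 a b
  have j3 := integrable_finsetSum Finset.univ fun a _ => j2 a
  refine ⟨(i0.add j1).add j3, ?_⟩
  unfold Fd
  have j4 : Integrable fun y : Sp => u (Th s y, y) ^ 2 + ∑ a, Lb a u (Th s y, y) ^ 2 := i0.add j1
  rw [integral_add j4 j3, integral_add i0 j1, integral_finsetSum _ fun a _ => i1 a,
    integral_finsetSum _ fun a _ => j2 a]
  simp_rw [fun a => integral_finsetSum Finset.univ fun b _ => i2 a b, l2_sq]

lemma pointwise {u : Spt → ℝ} (hu : ContDiff ℝ (⊤ : ℕ∞) u) {s : ℝ} (hs : 1 < s) (x w : Sp)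
    (hw : ‖w‖ = 1) :
    u (Th s x, x) ^ 2 ≤ ∫ r in (0:ℝ)..1, r ^ 2 * (225 * Fd u s (x + (Th s x / 2) • (r • w))) := by
  set ρ := Th s x / 2 with hρ
  have hρ0 : 0 < ρ := by have := Th_pos hs x; positivity
  set e : Sp := ρ • w with hedef
  have hen : ‖e‖ = ρ := by rw [hedef, norm_smul, hw, mul_one, Real.norm_of_nonneg hρ0.le]
  have hcomm : ∀ r : ℝ, ρ • r • w = r • e := fun r => smul_comm _ _ _
  simp_rw [hcomm]
  have hγ : Continuous fun r : ℝ => x + r • e := by fun_prop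
  have cT : Continuous fun r : ℝ => Th s (x + r • e) := (Th_cont s).comp hγ
  have c1 := fun a => (rest_cont (Lb_contDiff a hu) s).comp hγ
  have c2 := fun a b => (rest_cont (Lb_contDiff b (Lb_contDiff a hu)) s).comp hγ
  have hne := fun r : ℝ => (Th_pos hs (x + r • e)).ne'
  have := one_dim (fun r => u (Th s (x + r • e), x + r • e))
    (fun r => (∑ a, e a * Lb a u (Th s (x + r • e), x + r • e)) / Th s (x + r • e))
    (fun r => ((∑ a, e a * ((∑ b, e b * Lb b (Lb a u) (Th s (x + r • e), x + r • e))
        / Th s (x + r • e))) * Th s (x + r • e)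
      - (∑ a, e a * Lb a u (Th s (x + r • e), x + r • e))
        * (⟪x + r • e, e⟫ / Th s (x + r • e))) / Th s (x + r • e) ^ 2)
    (fun r => line_deriv hs hu x e r) ?_ ?_
    (fun r => 225 * Fd u s (x + r • e)) ?_ ?_
  · simpa using this
  · intro r
    refine HasDerivAt.fun_div ?_ (Th_deriv hs x e r) (hne r)
    exact HasDerivAt.fun_sum fun a _ => (line_deriv hs (Lb_contDiff a hu) x e r).const_mul (e a)
  · simp only [Function.comp_def] at c1 c2
    have hne2 := fun r : ℝ => pow_ne_zero 2 (hne r)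
    refine Continuous.div (Continuous.sub (Continuous.mul (continuous_finsetSum _ fun a _ =>
      continuous_const.mul (Continuous.div (continuous_finsetSum _ fun b _ =>
        continuous_const.mul (c2 a b)) cT hne)) cT)
      (Continuous.mul (continuous_finsetSum _ fun a _ => continuous_const.mul (c1 a))
        (Continuous.div (hγ.inner continuous_const) cT hne))) (cT.pow 2) hne2
  · exact continuous_const.mul ((Fd_cont hu s).comp hγ)
  · intro r hr
    have hre : ‖r • e‖ ≤ ρ := by
      rw [norm_smul, hen, Real.norm_of_nonneg hr.1]
      exact mul_le_of_le_one_left hρ0.le hr.2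
    have hTρ : ρ ≤ Th s (x + r • e) := by
      have := Th_lip hs x (r • e)
      linarith
    refine alg_bound e _ (fun a b => Lb b (Lb a u) (Th s (x + r • e), x + r • e)) _ _ _
      (Th_pos hs _) (fun a => ?_) ?_
    · have := PiLp.norm_apply_le e a
      rw [Real.norm_eq_abs, hen] at this
      exact this.trans hTρ
    · refine (abs_real_inner_le_norm _ _).trans ?_
      rw [hen]
      exact mul_le_mul (norm_le_Th hs _) hTρ hρ0.le (Th_pos hs _).le

/-- **Sobolev inequality on hyperboloids.** There is a universal constant
`C > 0` such that for every smooth `u` supported in the cone `{|x| ≤ t − 1}`, every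
`s > 1` and every point `(t, x) ∈ H_s` with `t = √(s² + |x|²)`,
`|u(t,x)| ≤ C t^{−3/2} Σ_J ‖L^J u‖_{L²(H_s)}`, the sum ranging over all products of at
most two Lorentz boosts. -/
theorem hyperboloidal_sobolev_inequality :
    ∃ C : ℝ, 0 < C ∧
      ∀ u : Spt → ℝ, ContDiff ℝ (⊤ : ℕ∞) u →
        (∀ p : Spt, u p ≠ 0 → ‖p.2‖ ≤ p.1 - 1) →
        ∀ s : ℝ, 1 < s → ∀ p : Spt, p.1 = Real.sqrt (s ^ 2 + ‖p.2‖ ^ 2) →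
          |u p| ≤ C * p.1 ^ (-(3 : ℝ) / 2) *
            (l2Hyp u s
              + (∑ a : Fin 3, l2Hyp (Lb a u) s)
              + ∑ a : Fin 3, ∑ b : Fin 3, l2Hyp (fun q => Lb a (Lb b u) q) s) := by
  have hσ : 0 < (volume : Measure Sp).toSphere.real Set.univ := by
    rw [Measure.toSphere_real_apply_univ]
    have : 0 < (volume : Measure Sp).real (Metric.ball 0 1) :=
      ENNReal.toReal_pos (Metric.measure_ball_pos _ _ one_pos).ne' measure_ball_lt_top.ne
    simp only [finrank_euclideanSpace, Fintype.card_fin]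
    positivity
  set σ := (volume : Measure Sp).toSphere.real Set.univ with hσdef
  refine ⟨Real.sqrt (1800 / σ), by positivity, ?_⟩
  intro u hu hsupp s hs p hp
  obtain ⟨t, x⟩ := p
  have ht : t = Th s x := hp
  subst ht
  have hT := Th_pos hs x
  obtain ⟨hi, hI⟩ := Fd_int hu hsupp s
  have hmain := polar_bound (fun z => 225 * Fd u s (x + (Th s x / 2) • z))
    (continuous_const.mul ((Fd_cont hu s).comp (by fun_prop)))
    (fun z => by unfold Fd; positivity)
    (((hi.comp_add_left x).comp_smul (by positivity : Th s x / 2 ≠ 0)).const_mul 225)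
    (u (Th s x, x) ^ 2) (fun w hw => pointwise hu hs x w hw)
  rw [integral_const_mul, Measure.integral_comp_smul volume (fun z => Fd u s (x + z)),
    integral_add_left_eq_self (Fd u s) x, hI, ← hσdef] at hmain
  simp only [finrank_euclideanSpace, Fintype.card_fin, smul_eq_mul] at hmain
  rw [abs_of_pos (by positivity)] at hmain
  have hS : l2Hyp u s ^ 2 + ∑ a, l2Hyp (Lb a u) s ^ 2
      + ∑ a, ∑ b, l2Hyp (Lb b (Lb a u)) s ^ 2 ≤ (l2Hyp u s
              + (∑ a : Fin 3, l2Hyp (Lb a u) s)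
              + ∑ a : Fin 3, ∑ b : Fin 3, l2Hyp (fun q => Lb a (Lb b u) q) s) ^ 2 := by
    rw [Finset.sum_comm]
    have k0 := l2_nonneg u s
    have k1 : 0 ≤ ∑ a : Fin 3, l2Hyp (Lb a u) s := Finset.sum_nonneg fun _ _ => l2_nonneg _ _
    have k2 : ∀ a, 0 ≤ ∑ b : Fin 3, l2Hyp (Lb a (Lb b u)) s :=
      fun a => Finset.sum_nonneg fun _ _ => l2_nonneg _ _
    have k3 : 0 ≤ ∑ a : Fin 3, ∑ b : Fin 3, l2Hyp (Lb a (Lb b u)) s :=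
      Finset.sum_nonneg fun _ _ => k2 _
    have m1 : ∑ a, l2Hyp (Lb a u) s ^ 2 ≤ (∑ a : Fin 3, l2Hyp (Lb a u) s) ^ 2 :=
      Finset.sum_sq_le_sq_sum_of_nonneg fun _ _ => l2_nonneg _ _
    have m2 : ∑ a, ∑ b, l2Hyp (Lb a (Lb b u)) s ^ 2
        ≤ (∑ a : Fin 3, ∑ b : Fin 3, l2Hyp (Lb a (Lb b u)) s) ^ 2 :=
      (Finset.sum_le_sum fun a _ => Finset.sum_sq_le_sq_sum_of_nonneg fun _ _ => l2_nonneg _ _).trans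
        (Finset.sum_sq_le_sq_sum_of_nonneg fun a _ => k2 a)
    change _ ≤ (_ + _ + ∑ a : Fin 3, ∑ b : Fin 3, l2Hyp (Lb a (Lb b u)) s) ^ 2
    nlinarith [mul_nonneg k0 k1, mul_nonneg k0 k3, mul_nonneg k1 k3]
  have hS0 : 0 ≤ (l2Hyp u s
              + (∑ a : Fin 3, l2Hyp (Lb a u) s)
              + ∑ a : Fin 3, ∑ b : Fin 3, l2Hyp (fun q => Lb a (Lb b u) q) s) :=
    add_nonneg (add_nonneg (l2_nonneg _ _) (Finset.sum_nonneg fun _ _ => l2_nonneg _ _))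
      (Finset.sum_nonneg fun _ _ => Finset.sum_nonneg fun _ _ => l2_nonneg _ _)
  generalize (l2Hyp u s
              + (∑ a : Fin 3, l2Hyp (Lb a u) s)
              + ∑ a : Fin 3, ∑ b : Fin 3, l2Hyp (fun q => Lb a (Lb b u) q) s) = S at hS hS0 ⊢
  refine abs_le_of_sq_le_sq ?_ (by positivity)
  have hpow : ((Th s x) ^ (-(3:ℝ) / 2)) ^ 2 = (Th s x ^ 3)⁻¹ := by
    rw [← Real.rpow_natCast, ← Real.rpow_mul hT.le, ← Real.rpow_natCast, ← Real.rpow_neg hT.le]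
    norm_num
  show u (Th s x, x) ^ 2 ≤ (Real.sqrt (1800 / σ) * Th s x ^ (-(3:ℝ) / 2) * S) ^ 2
  rw [mul_pow, mul_pow, hpow, Real.sq_sqrt (by positivity)]
  have e1 : 1800 / σ * (Th s x ^ 3)⁻¹ * S ^ 2 = (225 * (((Th s x / 2) ^ 3)⁻¹ * S ^ 2)) / σ := by
    field_simp
    ring
  rw [e1, le_div_iff₀ hσ]
  refine hmain.trans ?_
  gcongr
end
end

section
/- Let c > 0, let u₀, u₁ : ℝ³ → ℝ be smooth and compactly supported, and let u : ℝ × ℝ³ → ℝ be the smooth solution of the Klein–Gordon equation ∂_t² u − Δu + c² u = 0 with u(0, ·) = u₀ and ∂_t u(0, ·) = u₁. Then there exists a constant C (depending on c, u₀, u₁) such that |u(t, x)| ≤ C (1 + t)^{−3/2} for all t ≥ 0 and all x ∈ ℝ³. (Solutions of the Klein–Gordon equation in 3 + 1 dimensions decay at the rate O(t^{−3/2}), in contrast with the O(t^{−1}) rate for the wave equation.) -/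
noncomputable section

open scoped BigOperators

noncomputable section
open scoped BigOperators

/-- basis vectors of spacetime -/
def kgE (i : Fin 4) : Spt :=
  ![((1 : ℝ), (0 : Sp)), (0, EuclideanSpace.single 0 1), (0, EuclideanSpace.single 1 1),
    (0, EuclideanSpace.single 2 1)] i

/-- coordinates -/
def kgX (i : Fin 4) (p : Spt) : ℝ := ![p.1, p.2 0, p.2 1, p.2 2] i

/-- signature -/
def kgEta (i : Fin 4) : ℝ := ![1, -1, -1, -1] i

/-- directional derivative -/
def kgD (i : Fin 4) (v : Spt → ℝ) (p : Spt) : ℝ := fderiv ℝ v p (kgE i)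

/-- smoothness -/
abbrev Smo (v : Spt → ℝ) : Prop := ContDiff ℝ (⊤ : ℕ∞) v

lemma Smo.differentiable {v : Spt → ℝ} (h : Smo v) : Differentiable ℝ v :=
  ContDiff.differentiable h (by simp)

lemma Smo.padd {v w : Spt → ℝ} (h : Smo v) (h' : Smo w) : Smo (v + w) := ContDiff.add h h'
lemma Smo.psub {v w : Spt → ℝ} (h : Smo v) (h' : Smo w) : Smo (v - w) := ContDiff.sub h h'
lemma Smo.pmul {v w : Spt → ℝ} (h : Smo v) (h' : Smo w) : Smo (v * w) := ContDiff.mul h h'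
lemma Smo.psmul {v : Spt → ℝ} (a : ℝ) (h : Smo v) : Smo (a • v) := ContDiff.const_smul a h

lemma kgD_smo {v : Spt → ℝ} (h : Smo v) (i : Fin 4) : Smo (kgD i v) := by
  unfold kgD
  exact (h.fderiv_right (m := (⊤ : ℕ∞)) (by simp)).clm_apply contDiff_const

lemma kgX_smo (i : Fin 4) : Smo (kgX i) := by
  fin_cases i
  · exact contDiff_fst
  all_goals
    exact (EuclideanSpace.proj _ : Sp →L[ℝ] ℝ).contDiff.comp contDiff_snd

lemma kgD_comm {v : Spt → ℝ} (h : Smo v) (i j : Fin 4) : kgD i (kgD j v) = kgD j (kgD i v) := by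
  funext p
  have hs : IsSymmSndFDerivAt ℝ v p := h.contDiffAt.isSymmSndFDerivAt (by simp only [minSmoothness_of_isRCLikeNormedField]; exact WithTop.coe_le_coe.2 (le_top : (2 : ℕ∞) ≤ ⊤))
  have hd : Differentiable ℝ (fderiv ℝ v) :=
    (h.fderiv_right (m := (⊤ : ℕ∞)) (by simp)).differentiable (by simp)
  have key : ∀ a b : Spt, fderiv ℝ (fun q => fderiv ℝ v q a) p b = fderiv ℝ (fderiv ℝ v) p b a := by
    intro a b
    rw [fderiv_clm_apply (hd p) (differentiableAt_const _)]
    simp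
  have e1 : ∀ k, kgD k v = fun q => fderiv ℝ v q (kgE k) := fun k => rfl
  unfold kgD
  rw [key, key]
  exact hs _ _

lemma kgD_X (i j : Fin 4) : kgD i (kgX j) = fun _ => if i = j then 1 else 0 := by
  funext p
  have h0 : ∀ q : Spt, HasFDerivAt (kgX 0) (ContinuousLinearMap.fst ℝ ℝ Sp) q := fun q =>
    (ContinuousLinearMap.fst ℝ ℝ Sp).hasFDerivAt
  have h1 : ∀ (a : Fin 3) (q : Spt), HasFDerivAt (fun p : Spt => p.2 a)
      ((EuclideanSpace.proj a : Sp →L[ℝ] ℝ).comp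
        (ContinuousLinearMap.snd ℝ ℝ Sp)) q := fun a q =>
    ((EuclideanSpace.proj a : Sp →L[ℝ] ℝ).comp
        (ContinuousLinearMap.snd ℝ ℝ Sp)).hasFDerivAt
  have e1 : kgX 1 = fun p : Spt => p.2 0 := rfl
  have e2 : kgX 2 = fun p : Spt => p.2 1 := rfl
  have e3 : kgX 3 = fun p : Spt => p.2 2 := rfl
  unfold kgD
  have hj : j = 0 ∨ j = 1 ∨ j = 2 ∨ j = 3 := by fin_cases j <;> simp
  rcases hj with rfl | rfl | rfl | rfl
  · rw [(h0 p).fderiv]; fin_cases i <;> simp [kgE]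
  · rw [e1, (h1 0 p).fderiv]; fin_cases i <;> simp [kgE]
  · rw [e2, (h1 1 p).fderiv]; fin_cases i <;> simp [kgE]
  · rw [e3, (h1 2 p).fderiv]; fin_cases i <;> simp [kgE]

lemma kgD_add {v w : Spt → ℝ} (hv : Smo v) (hw : Smo w) (i : Fin 4) :
    kgD i (v + w) = kgD i v + kgD i w := by
  funext p; unfold kgD
  rw [fderiv_add (hv.differentiable p) (hw.differentiable p)]; rfl

lemma kgD_sub {v w : Spt → ℝ} (hv : Smo v) (hw : Smo w) (i : Fin 4) :
    kgD i (v - w) = kgD i v - kgD i w := by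
  funext p; unfold kgD
  rw [fderiv_sub (hv.differentiable p) (hw.differentiable p)]; rfl

lemma kgD_mul {v w : Spt → ℝ} (hv : Smo v) (hw : Smo w) (i : Fin 4) :
    kgD i (v * w) = kgD i v * w + v * kgD i w := by
  funext p; unfold kgD
  rw [fderiv_mul (hv.differentiable p) (hw.differentiable p)]
  simp; ring

lemma kgD_smul {v : Spt → ℝ} (hv : Smo v) (a : ℝ) (i : Fin 4) :
    kgD i (a • v) = a • kgD i v := by
  funext p; unfold kgD
  rw [fderiv_const_smul (hv.differentiable p)]; rfl

/-- Lorentz fields -/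
def kgZ (i j : Fin 4) (v : Spt → ℝ) : Spt → ℝ :=
  kgEta i • (kgX i * kgD j v) - kgEta j • (kgX j * kgD i v)

lemma kgZ_smo {v : Spt → ℝ} (h : Smo v) (i j : Fin 4) : Smo (kgZ i j v) := by
  unfold kgZ
  have := (kgX_smo i).pmul (kgD_smo h j)
  have := (kgX_smo j).pmul (kgD_smo h i)
  exact Smo.psub (Smo.psmul _ ‹_›) (Smo.psmul _ ‹_›)

lemma kgD_Z {v : Spt → ℝ} (h : Smo v) (i j k : Fin 4) :
    kgD k (kgZ i j v) = (kgEta i * if k = i then 1 else 0) • kgD j v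
      - (kgEta j * if k = j then 1 else 0) • kgD i v + kgZ i j (kgD k v) := by
  have a1 := (kgX_smo i).pmul (kgD_smo h j)
  have a2 := (kgX_smo j).pmul (kgD_smo h i)
  have h1 : kgD k (kgZ i j v) = kgEta i • kgD k (kgX i * kgD j v)
      - kgEta j • kgD k (kgX j * kgD i v) := by
    rw [← kgD_smul a1, ← kgD_smul a2, ← kgD_sub (Smo.psmul _ a1) (Smo.psmul _ a2)]
    rfl
  rw [h1, kgD_mul (kgX_smo i) (kgD_smo h j), kgD_mul (kgX_smo j) (kgD_smo h i), kgD_X, kgD_X,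
    kgD_comm h k j, kgD_comm h k i]
  funext p
  simp only [kgZ, Pi.add_apply, Pi.sub_apply, Pi.smul_apply, Pi.mul_apply, smul_eq_mul]
  ring

/-- the Klein Gordon property -/
def IsKG (c : ℝ) (v : Spt → ℝ) : Prop :=
  ∀ p, kgD 0 (kgD 0 v) p = kgD 1 (kgD 1 v) p + kgD 2 (kgD 2 v) p + kgD 3 (kgD 3 v) p - c ^ 2 * v p

lemma IsKG.fun_eq {c : ℝ} {v : Spt → ℝ} (h : IsKG c v) :
    kgD 0 (kgD 0 v) = kgD 1 (kgD 1 v) + kgD 2 (kgD 2 v) + kgD 3 (kgD 3 v) - c ^ 2 • v := by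
  funext p; simp [h p]

lemma IsKG.fun_eq_D {c : ℝ} {v : Spt → ℝ} (h : IsKG c v) (hv : Smo v) (i : Fin 4) :
    IsKG c (kgD i v) := by
  have hh := congrArg (kgD i) h.fun_eq
  have s : ∀ j k, Smo (kgD j (kgD k v)) := fun j k => kgD_smo (kgD_smo hv k) j
  rw [kgD_sub (((s 1 1).padd (s 2 2)).padd (s 3 3)) (Smo.psmul _ hv),
    kgD_add ((s 1 1).padd (s 2 2)) (s 3 3), kgD_add (s 1 1) (s 2 2), kgD_smul hv] at hh
  have cc : ∀ k, kgD i (kgD k (kgD k v)) = kgD k (kgD k (kgD i v)) := fun k => by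
    rw [kgD_comm (kgD_smo hv k), kgD_comm hv i k]
  rw [cc, cc, cc, cc] at hh
  intro p
  have := congrFun hh p
  simpa using this

lemma kgDD_Z {v : Spt → ℝ} (h : Smo v) (i j k : Fin 4) (p : Spt) :
    kgD k (kgD k (kgZ i j v)) p = 2 * (kgEta i * if k = i then 1 else 0) * kgD j (kgD k v) p
      - 2 * (kgEta j * if k = j then 1 else 0) * kgD i (kgD k v) p
      + kgZ i j (kgD k (kgD k v)) p := by
  have s := kgD_smo h
  rw [kgD_Z h, kgD_add (Smo.psub (Smo.psmul _ (s _)) (Smo.psmul _ (s _)))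
    (kgZ_smo (s k) i j), kgD_sub (Smo.psmul _ (s _)) (Smo.psmul _ (s _)),
    kgD_smul (s _), kgD_smul (s _), kgD_Z (s k), kgD_comm h k j, kgD_comm h k i]
  simp only [Pi.add_apply, Pi.sub_apply, Pi.smul_apply, smul_eq_mul]
  ring

lemma IsKG.Z {c : ℝ} {v : Spt → ℝ} (h : IsKG c v) (hv : Smo v) (i j : Fin 4) :
    IsKG c (kgZ i j v) := by
  intro p
  have hD : ∀ l, kgD l (kgD 0 (kgD 0 v)) p = kgD l (kgD 1 (kgD 1 v)) p + kgD l (kgD 2 (kgD 2 v)) p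
      + kgD l (kgD 3 (kgD 3 v)) p - c ^ 2 * kgD l v p := by
    intro l
    have cc : ∀ k, kgD l (kgD k (kgD k v)) = kgD k (kgD k (kgD l v)) := fun k => by
      rw [kgD_comm (kgD_smo hv k), kgD_comm hv l k]
    rw [cc, cc, cc, cc]
    exact h.fun_eq_D hv l p
  simp only [kgDD_Z hv]
  simp only [kgZ, Pi.sub_apply, Pi.smul_apply, Pi.mul_apply, smul_eq_mul, hD]
  by_cases hij : i = j
  · subst hij; ring
  have cm := fun a b => congrFun (kgD_comm hv a b) p
  fin_cases i <;> fin_cases j <;> simp [kgEta, cm 1 0, cm 2 0, cm 3 0, cm 2 1, cm 3 1, cm 3 2] <;> ring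

/-- Casimir of the Lorentz group -/
def kgCas (v : Spt → ℝ) (p : Spt) : ℝ :=
  kgZ 0 1 (kgZ 0 1 v) p + kgZ 0 2 (kgZ 0 2 v) p + kgZ 0 3 (kgZ 0 3 v) p
  - kgZ 1 2 (kgZ 1 2 v) p - kgZ 1 3 (kgZ 1 3 v) p - kgZ 2 3 (kgZ 2 3 v) p

lemma kgCas_eq {v : Spt → ℝ} (hv : Smo v) (p : Spt) :
    (∑ i, ∑ j, kgX i p * kgX j p * kgD i (kgD j v) p) + 3 * ∑ i, kgX i p * kgD i v p
    = (kgX 0 p ^ 2 - kgX 1 p ^ 2 - kgX 2 p ^ 2 - kgX 3 p ^ 2) *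
      (kgD 0 (kgD 0 v) p - kgD 1 (kgD 1 v) p - kgD 2 (kgD 2 v) p - kgD 3 (kgD 3 v) p)
      + kgCas v p := by
  have cm := fun a b => congrFun (kgD_comm hv a b) p
  have hZ : ∀ i j : Fin 4, kgZ i j (kgZ i j v) p =
      kgEta i * (kgX i p * kgD j (kgZ i j v) p) - kgEta j * (kgX j p * kgD i (kgZ i j v) p) :=
    fun i j => rfl
  simp only [kgCas, hZ, kgD_Z hv]
  simp [Fin.sum_univ_four, kgZ, kgEta, cm 1 0, cm 2 0, cm 3 0, cm 2 1, cm 3 1, cm 3 2]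
  ring

end

noncomputable section
open scoped BigOperators

lemma kg_ode_bound (c : ℝ) (W W1 W2 : ℝ → ℝ) (s0 s1 K β A B : ℝ) (hs0 : 0 < s0) (hs : s0 ≤ s1)
    (hβ : β ≠ 0) (hc : 0 < c)
    (h1 : ∀ s, 0 < s → HasDerivAt W (W1 s) s) (h2 : ∀ s, 0 < s → HasDerivAt W1 (W2 s) s)
    (hK : ∀ s, s0 ≤ s → |W2 s + c ^ 2 * W s| ≤ K * s ^ (β - 1))
    (hA : |W s0| ≤ A) (hB : |W1 s0| ≤ B) :
    c * |W s1| ≤ (B + c * A) + K * ((s1 ^ β - s0 ^ β) / β) := by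
  set g : ℝ → ℝ := fun r => Real.sin (c * (s1 - r)) * W1 r + c * Real.cos (c * (s1 - r)) * W r
  have hg : ∀ s, 0 < s → HasDerivAt g (Real.sin (c * (s1 - s)) * (W2 s + c ^ 2 * W s)) s := by
    intro s hs
    have hl : HasDerivAt (fun r : ℝ => c * (s1 - r)) (-c) s := by
      simpa using ((hasDerivAt_id s).const_sub s1).const_mul c
    have := (hl.sin.mul (h2 s hs)).add ((hl.cos.const_mul c).mul (h1 s hs))
    exact this.congr_deriv (by ring)
  have key : ‖g s1‖ ≤ (B + c * A) + K * ((s1 ^ β - s0 ^ β) / β) := by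
    refine image_norm_le_of_norm_deriv_right_le_deriv_boundary' (f := g)
      (f' := fun s => Real.sin (c * (s1 - s)) * (W2 s + c ^ 2 * W s)) (a := s0) (b := s1)
      (B := fun s => (B + c * A) + K * ((s ^ β - s0 ^ β) / β)) (B' := fun s => K * s ^ (β - 1))
      ?_ ?_ ?_ ?_ ?_ ?_ (Set.right_mem_Icc.2 hs)
    · intro x hx
      exact (hg x (hs0.trans_le hx.1)).continuousAt.continuousWithinAt
    · intro x hx
      exact (hg x (hs0.trans_le hx.1)).hasDerivWithinAt
    · simp only [sub_self, zero_div, mul_zero, add_zero, Real.norm_eq_abs, g]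
      refine (abs_add_le _ _).trans (add_le_add ?_ ?_)
      · rw [abs_mul]
        nlinarith [Real.abs_sin_le_one (c * (s1 - s0)), abs_nonneg (W1 s0)]
      · rw [abs_mul, abs_mul, abs_of_pos hc, mul_assoc]
        refine mul_le_mul_of_nonneg_left ?_ hc.le
        nlinarith [Real.abs_cos_le_one (c * (s1 - s0)), abs_nonneg (W s0)]
    · intro x hx
      have hx0 : x ≠ 0 := (hs0.trans_le hx.1).ne'
      exact (((((Real.hasDerivAt_rpow_const (p := β) (Or.inl hx0)).sub_const _).div_const _).const_mul
        _).const_add _).continuousAt.continuousWithinAt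
    · intro x hx
      have hx0 : x ≠ 0 := (hs0.trans_le hx.1).ne'
      have := (((((Real.hasDerivAt_rpow_const (p := β) (Or.inl hx0)).sub_const (s0 ^ β)).div_const
        β).const_mul K).const_add (B + c * A))
      refine HasDerivAt.hasDerivWithinAt ?_
      convert this using 1
      field_simp
    · intro x hx
      rw [Real.norm_eq_abs, abs_mul]
      refine le_trans ?_ (hK x hx.1)
      nlinarith [Real.abs_sin_le_one (c * (s1 - x)), abs_nonneg (W2 x + c ^ 2 * W x)]
  have : g s1 = c * W s1 := by simp [g]
  rw [this, Real.norm_eq_abs, abs_mul, abs_of_pos hc] at key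
  exact key

/-- class of solutions vanishing outside of the shifted cone -/
structure KCl (c R : ℝ) (v : Spt → ℝ) : Prop where
  smo : Smo v
  kg : IsKG c v
  van : ∀ p : Spt, 2 * R < p.1 → p.1 - R < ‖p.2‖ → v p = 0

lemma KCl.ev {c R : ℝ} {v : Spt → ℝ} (h : KCl c R v) {p : Spt} (h1 : 2 * R < p.1)
    (h2 : p.1 - R < ‖p.2‖) : v =ᶠ[nhds p] fun _ => 0 := by
  have o1 : IsOpen {p : Spt | 2 * R < p.1} := isOpen_lt continuous_const continuous_fst
  have o2 : IsOpen {p : Spt | p.1 - R < ‖p.2‖} :=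
    isOpen_lt (continuous_fst.sub continuous_const) continuous_snd.norm
  filter_upwards [o1.mem_nhds h1, o2.mem_nhds h2] with q hq1 hq2
  exact h.van q hq1 hq2

lemma KCl.fd {c R : ℝ} {v : Spt → ℝ} (h : KCl c R v) {p : Spt} (h1 : 2 * R < p.1)
    (h2 : p.1 - R < ‖p.2‖) : fderiv ℝ v p = 0 := by
  rw [(h.ev h1 h2).fderiv_eq]; simp

lemma KCl.D {c R : ℝ} {v : Spt → ℝ} (h : KCl c R v) (i : Fin 4) : KCl c R (kgD i v) where
  smo := kgD_smo h.smo i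
  kg := h.kg.fun_eq_D h.smo i
  van p h1 h2 := by simp [kgD, h.fd h1 h2]

lemma KCl.Z {c R : ℝ} {v : Spt → ℝ} (h : KCl c R v) (i j : Fin 4) : KCl c R (kgZ i j v) where
  smo := kgZ_smo h.smo i j
  kg := h.kg.Z h.smo i j
  van p h1 h2 := by simp [kgZ, (h.D _).van p h1 h2]

/-- weighted bound in hyperbolic coordinates -/
def PB (R : ℝ) (a b : ℝ) (v : Spt → ℝ) : Prop :=
  ∃ C, 0 ≤ C ∧ ∀ q : Spt, 0 < q.1 → q.1 ^ 2 - ‖q.2‖ ^ 2 = 1 → ∀ s, R * q.1 ≤ s →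
    |v (s • q)| ≤ C * q.1 ^ a * s ^ b

lemma kg_sum_E (q : Spt) : q = ∑ i, kgX i q • kgE i := by
  ext j
  · simp [Fin.sum_univ_four, kgX, kgE]
  · fin_cases j <;> simp [Fin.sum_univ_four, kgX, kgE]

lemma fderiv_eq_sum (v : Spt → ℝ) (p q : Spt) : fderiv ℝ v p q = ∑ i, kgX i q * kgD i v p := by
  conv_lhs => rw [kg_sum_E q]
  simp [kgD, map_sum]

lemma kgX_smul (i : Fin 4) (s : ℝ) (q : Spt) : kgX i (s • q) = s * kgX i q := by
  fin_cases i <;> simp [kgX]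

lemma ray_deriv {v : Spt → ℝ} (hv : Smo v) (q : Spt) (s : ℝ) :
    HasDerivAt (fun r : ℝ => v (r • q)) (∑ i, kgX i q * kgD i v (s • q)) s := by
  have h1 : HasDerivAt (fun r : ℝ => r • q) q s := by
    simpa using (hasDerivAt_id s).smul_const q
  have := ((hv.differentiable (s • q)).hasFDerivAt).comp_hasDerivAt s h1
  rwa [fderiv_eq_sum] at this

lemma kg_normsq (q : Spt) : ‖q.2‖ ^ 2 = kgX 1 q ^ 2 + kgX 2 q ^ 2 + kgX 3 q ^ 2 := by
  rw [EuclideanSpace.real_norm_sq_eq]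
  simp [Fin.sum_univ_three, kgX]

lemma KCl.core {c R : ℝ} (hc : 0 < c) (hR : 1 ≤ R) {v : Spt → ℝ} (h : KCl c R v) (a b e : ℝ)
    (hb : b + 1 / 2 ≠ 0)
    (hF : PB R a b (fun p => 3 / 4 * v p + kgCas v p)) :
    ∃ A C, 0 ≤ A ∧ 0 ≤ C ∧ ∀ q : Spt, 0 < q.1 → q.1 ^ 2 - ‖q.2‖ ^ 2 = 1 → ∀ s, R * q.1 ≤ s →
    c * (s ^ (3 / 2 : ℝ) * |v (s • q)|) ≤ A * q.1 ^ e
      + C * q.1 ^ a * ((s ^ (b + 1 / 2) - (R * q.1) ^ (b + 1 / 2)) / (b + 1 / 2)) := by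
  obtain ⟨C, hC0, hC⟩ := hF
  -- compact bounds
  have hcomp : IsCompact (Metric.closedBall (0 : Spt) (2 * R)) := isCompact_closedBall _ _
  obtain ⟨M1, hM1⟩ := hcomp.exists_bound_of_continuousOn h.smo.continuous.continuousOn
  obtain ⟨M2, hM2⟩ := hcomp.exists_bound_of_continuousOn
    (h.smo.continuous_fderiv (by simp)).continuousOn
  have hM1' : 0 ≤ M1 := (norm_nonneg _).trans (hM1 0 (by simp; linarith))
  have hM2' : 0 ≤ M2 := (norm_nonneg _).trans (hM2 0 (by simp; linarith))
  set A1 : ℝ := (2 * R) ^ (3 / 2 : ℝ) * M1 with hA1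
  set A2 : ℝ := 3 / 2 * (2 * R) ^ (1 / 2 : ℝ) * M1 + (2 * R) ^ (3 / 2 : ℝ) * (M2 * 2) with hA2
  have hA1' : 0 ≤ A1 := by positivity
  have hA2' : 0 ≤ A2 := by positivity
  refine ⟨(A2 + c * A1) * 2 ^ |e|, C, by positivity, hC0, ?_⟩
  intro q hq0 hq s hs
  have hq1 : 1 ≤ q.1 := by nlinarith [sq_nonneg ‖q.2‖]
  have hs0 : 0 < R * q.1 := by positivity
  have hsp : 0 < s := hs0.trans_le hs
  set f : ℝ → ℝ := fun r => v (r • q)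
  set f1 : ℝ → ℝ := fun r => ∑ i, kgX i q * kgD i v (r • q)
  set f2 : ℝ → ℝ := fun r => ∑ i, kgX i q * ∑ j, kgX j q * kgD j (kgD i v) (r • q)
  have hf1 : ∀ r, HasDerivAt f (f1 r) r := fun r => ray_deriv h.smo q r
  have hf2 : ∀ r, HasDerivAt f1 (f2 r) r := fun r =>
    HasDerivAt.fun_sum fun i _ => (ray_deriv (kgD_smo h.smo i) q r).const_mul _
  set W : ℝ → ℝ := fun r => r ^ (3 / 2 : ℝ) * f r
  set W1 : ℝ → ℝ := fun r => 3 / 2 * r ^ (1 / 2 : ℝ) * f r + r ^ (3 / 2 : ℝ) * f1 r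
  set W2 : ℝ → ℝ := fun r => 3 / 4 * r ^ (-1 / 2 : ℝ) * f r + 3 * r ^ (1 / 2 : ℝ) * f1 r
    + r ^ (3 / 2 : ℝ) * f2 r
  have p32 : ∀ r : ℝ, 0 < r → HasDerivAt (fun r : ℝ => r ^ (3 / 2 : ℝ)) (3 / 2 * r ^ (1 / 2 : ℝ)) r := by
    intro r hr
    convert Real.hasDerivAt_rpow_const (p := 3 / 2) (Or.inl hr.ne') using 2
    norm_num
  have p12 : ∀ r : ℝ, 0 < r → HasDerivAt (fun r : ℝ => r ^ (1 / 2 : ℝ)) (1 / 2 * r ^ (-1 / 2 : ℝ)) r := by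
    intro r hr
    convert Real.hasDerivAt_rpow_const (p := 1 / 2) (Or.inl hr.ne') using 2
    norm_num
  have hW1 : ∀ r, 0 < r → HasDerivAt W (W1 r) r := fun r hr => (p32 r hr).mul (hf1 r)
  have hW2 : ∀ r, 0 < r → HasDerivAt W1 (W2 r) r := by
    intro r hr
    have := (((p12 r hr).const_mul (3 / 2)).mul (hf1 r)).add ((p32 r hr).mul (hf2 r))
    exact this.congr_deriv (by simp only [W2]; ring)
  have hWK : ∀ r, R * q.1 ≤ r → |W2 r + c ^ 2 * W r| ≤ C * q.1 ^ a * r ^ (b + 1 / 2 - 1) := by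
    intro r hr
    have hrp : 0 < r := hs0.trans_le hr
    have e1 : W2 r + c ^ 2 * W r = r ^ (-1 / 2 : ℝ) * (3 / 4 * v (r • q) + kgCas v (r • q)) := by
      have hcas := kgCas_eq h.smo (r • q)
      have hkg := h.kg (r • q)
      have hn := kg_normsq q
      have q0 : kgX 0 q = q.1 := rfl
      have r12 : r ^ (1 / 2 : ℝ) = r ^ (-1 / 2 : ℝ) * r := by
        conv_rhs => rw [← Real.rpow_add_one hrp.ne']
        norm_num
      have r32 : r ^ (3 / 2 : ℝ) = r ^ (-1 / 2 : ℝ) * r ^ 2 := by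
        conv_rhs => rw [← Real.rpow_add_natCast hrp.ne']
        norm_num
      have hs1 : ∑ i, kgX i (r • q) * kgD i v (r • q) = r * f1 r := by
        simp only [kgX_smul, f1, Finset.mul_sum, mul_assoc]
      have hs2 : ∑ i, ∑ j, kgX i (r • q) * kgX j (r • q) * kgD i (kgD j v) (r • q) = r ^ 2 * f2 r := by
        rw [Finset.sum_comm]
        simp only [kgX_smul, f2, Finset.mul_sum]
        exact Finset.sum_congr rfl fun i _ => Finset.sum_congr rfl fun j _ => by ring
      rw [hs1, hs2, hkg] at hcas
      simp only [kgX_smul, q0] at hcas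
      have : r ^ 2 * f2 r + 3 * (r * f1 r) = - r ^ 2 * c ^ 2 * v (r • q) + kgCas v (r • q) := by
        rw [hcas]
        have : q.1 ^ 2 = 1 + (kgX 1 q ^ 2 + kgX 2 q ^ 2 + kgX 3 q ^ 2) := by rw [← hn]; linarith
        simp only [mul_pow, this]
        ring
      simp only [W2, W, r12, r32]
      have hf : f r = v (r • q) := rfl
      rw [hf]
      linear_combination (r ^ (-1 / 2 : ℝ)) * this
    rw [e1, abs_mul, abs_of_pos (Real.rpow_pos_of_pos hrp _)]
    calc _ ≤ r ^ (-1 / 2 : ℝ) * (C * q.1 ^ a * r ^ b) :=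
          mul_le_mul_of_nonneg_left (hC q hq0 hq r hr) (by positivity)
      _ = C * q.1 ^ a * (r ^ b * r ^ (-1 / 2 : ℝ)) := by ring
      _ = _ := by rw [← Real.rpow_add hrp]; congr 2; ring
  have hinit : |W (R * q.1)| ≤ A1 * (2 ^ |e| * q.1 ^ e) ∧ |W1 (R * q.1)| ≤ A2 * (2 ^ |e| * q.1 ^ e) := by
    have hWd : W1 (R * q.1) = 3 / 2 * (R * q.1) ^ (1 / 2 : ℝ) * f (R * q.1)
        + (R * q.1) ^ (3 / 2 : ℝ) * fderiv ℝ v ((R * q.1) • q) q := by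
      rw [fderiv_eq_sum]
    by_cases hg : 2 < q.1 ^ 2
    · have c1 : 2 * R < ((R * q.1) • q).1 := by
        simp only [Prod.smul_fst, smul_eq_mul]; nlinarith
      have c2 : ((R * q.1) • q).1 - R < ‖((R * q.1) • q).2‖ := by
        simp only [Prod.smul_fst, Prod.smul_snd, smul_eq_mul, norm_smul, Real.norm_eq_abs,
          abs_of_pos hs0]
        have : q.1 ^ 2 - 1 < q.1 * ‖q.2‖ := by
          have h2 : ‖q.2‖ ^ 2 = q.1 ^ 2 - 1 := by linarith
          have : ‖q.2‖ < q.1 := by nlinarith [norm_nonneg q.2]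
          have : 0 < ‖q.2‖ := by
            rcases (norm_nonneg q.2).lt_or_eq with h | h
            · exact h
            · rw [← h] at h2; nlinarith
          nlinarith
        nlinarith
      have v0 : f (R * q.1) = 0 := h.van _ c1 c2
      rw [hWd, h.fd c1 c2]
      simp only [W, v0]
      constructor <;> simp <;> positivity
    · push Not at hg
      have hq2 : q.1 ≤ 2 := by nlinarith
      have hnq : ‖q.2‖ ≤ q.1 := by nlinarith [norm_nonneg q.2]
      have hq' : ‖q‖ ≤ 2 := by
        rw [Prod.norm_def]; refine max_le ?_ (hnq.trans hq2)
        rw [Real.norm_eq_abs, abs_of_pos hq0]; exact hq2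
      have hmem : (R * q.1) • q ∈ Metric.closedBall (0 : Spt) (2 * R) := by
        rw [mem_closedBall_zero_iff, norm_smul, Real.norm_eq_abs, abs_of_pos hs0]
        have : ‖q‖ ≤ q.1 := by
          rw [Prod.norm_def]; refine max_le ?_ hnq
          rw [Real.norm_eq_abs, abs_of_pos hq0]
        nlinarith
      have b1 : |f (R * q.1)| ≤ M1 := hM1 _ hmem
      have b2 : |fderiv ℝ v ((R * q.1) • q) q| ≤ M2 * 2 := by
        refine (ContinuousLinearMap.le_opNorm (fderiv ℝ v ((R * q.1) • q)) q).trans ?_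
        exact mul_le_mul (hM2 _ hmem) hq' (norm_nonneg _) hM2'
      have hone : 1 ≤ (2 : ℝ) ^ |e| * q.1 ^ e := by
        have : (2 : ℝ) ^ (-|e|) ≤ q.1 ^ e := by
          calc (2 : ℝ) ^ (-|e|) ≤ q.1 ^ (-|e|) :=
                Real.rpow_le_rpow_of_nonpos hq0 hq2 (by simp)
            _ ≤ q.1 ^ e := Real.rpow_le_rpow_of_exponent_le hq1 (neg_abs_le e)
        calc (1 : ℝ) = 2 ^ |e| * 2 ^ (-|e|) := by rw [← Real.rpow_add two_pos]; simp
          _ ≤ _ := mul_le_mul_of_nonneg_left this (by positivity)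
      have hle : R * q.1 ≤ 2 * R := by nlinarith
      have k1 : (R * q.1) ^ (3 / 2 : ℝ) ≤ (2 * R) ^ (3 / 2 : ℝ) :=
        Real.rpow_le_rpow hs0.le hle (by norm_num)
      have k2 : (R * q.1) ^ (1 / 2 : ℝ) ≤ (2 * R) ^ (1 / 2 : ℝ) :=
        Real.rpow_le_rpow hs0.le hle (by norm_num)
      have k3 := Real.rpow_nonneg hs0.le (3 / 2)
      have k4 := Real.rpow_nonneg hs0.le (1 / 2)
      constructor
      · refine le_trans ?_ (le_mul_of_one_le_right hA1' hone)
        simp only [W, abs_mul, abs_of_nonneg k3]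
        exact mul_le_mul k1 b1 (abs_nonneg _) (by positivity)
      · refine le_trans ?_ (le_mul_of_one_le_right hA2' hone)
        rw [hWd]
        refine (abs_add_le _ _).trans (add_le_add ?_ ?_)
        · rw [abs_mul, abs_mul, abs_of_nonneg k4, abs_of_nonneg (by norm_num : (0:ℝ) ≤ 3 / 2)]
          exact mul_le_mul (by linarith) b1 (abs_nonneg _) (by positivity)
        · rw [abs_mul, abs_of_nonneg k3]
          exact mul_le_mul k1 b2 (abs_nonneg _) (by positivity)
  have := kg_ode_bound c W W1 W2 (R * q.1) s (C * q.1 ^ a) (b + 1 / 2) _ _ hs0 hs hb hc hW1 hW2 hWK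
    hinit.1 hinit.2
  have hWs : |W s| = s ^ (3 / 2 : ℝ) * |v (s • q)| := by
    simp only [W, abs_mul, abs_of_nonneg (Real.rpow_nonneg hsp.le _)]; rfl
  rw [hWs] at this
  refine this.trans (le_of_eq ?_)
  ring

lemma PB.cas {R a b : ℝ} {v : Spt → ℝ} (hR : 0 < R) (hv : PB R a b v)
    (hZ : ∀ i j, PB R a b (kgZ i j (kgZ i j v))) :
    PB R a b (fun p => 3 / 4 * v p + kgCas v p) := by
  obtain ⟨C, hC0, hC⟩ := hv
  choose K hK0 hK using hZ
  refine ⟨C + K 0 1 + K 0 2 + K 0 3 + K 1 2 + K 1 3 + K 2 3, ?_, ?_⟩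
  · have := hK0 0 1; have := hK0 0 2; have := hK0 0 3; have := hK0 1 2; have := hK0 1 3
    have := hK0 2 3; positivity
  · intro q h1 h2 s hs
    have a0 := abs_le.1 (hC q h1 h2 s hs)
    have a1 := abs_le.1 (hK 0 1 q h1 h2 s hs)
    have a2 := abs_le.1 (hK 0 2 q h1 h2 s hs)
    have a3 := abs_le.1 (hK 0 3 q h1 h2 s hs)
    have a4 := abs_le.1 (hK 1 2 q h1 h2 s hs)
    have a5 := abs_le.1 (hK 1 3 q h1 h2 s hs)
    have a6 := abs_le.1 (hK 2 3 q h1 h2 s hs)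
    have hsp : 0 ≤ s := le_trans (by positivity) hs
    have hpos : 0 ≤ C * q.1 ^ a * s ^ b := by positivity
    simp only [kgCas]
    rw [abs_le]
    constructor <;> ring_nf at a0 a1 a2 a3 a4 a5 a6 hpos ⊢ <;> linarith [a0.1, a0.2, a1.1, a1.2]

lemma PB_step1 {c R : ℝ} (hc : 0 < c) (hR : 1 ≤ R) (a b b' : ℝ) (hb : 0 < b + 1 / 2) (hb' : b' = b - 1)
    (H : ∀ v, KCl c R v → PB R a b v) : ∀ v, KCl c R v → PB R a b' v := by
  intro v hv
  subst hb'
  obtain ⟨A, C, hA, hC, h⟩ := hv.core hc hR a b a hb.ne'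
    (PB.cas (by linarith) (H v hv) fun i j => H _ ((hv.Z i j).Z i j))
  refine ⟨(A + C / (b + 1 / 2)) / c, by positivity, ?_⟩
  intro q hq0 hq s hs
  have hq1 : 1 ≤ q.1 := by nlinarith [sq_nonneg ‖q.2‖]
  have hs1 : 1 ≤ s := by nlinarith
  have hsp : 0 < s := by linarith
  have h1 := h q hq0 hq s hs
  have h2 : (s ^ (b + 1 / 2) - (R * q.1) ^ (b + 1 / 2)) / (b + 1 / 2) ≤ s ^ (b + 1 / 2) / (b + 1 / 2) := by
    gcongr
    have : 0 ≤ (R * q.1) ^ (b + 1 / 2) := by positivity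
    linarith
  have h3 : 1 ≤ s ^ (b + 1 / 2) := Real.one_le_rpow hs1 hb.le
  have h4 : c * (s ^ (3 / 2 : ℝ) * |v (s • q)|) ≤ (A + C / (b + 1 / 2)) * q.1 ^ a * s ^ (b + 1 / 2) := by
    calc _ ≤ _ := h1
      _ ≤ A * q.1 ^ a * s ^ (b + 1 / 2) + C * q.1 ^ a * (s ^ (b + 1 / 2) / (b + 1 / 2)) := by
          refine add_le_add (le_mul_of_one_le_right (by positivity) h3) ?_
          exact mul_le_mul_of_nonneg_left h2 (by positivity)
      _ = _ := by ring
  have h5 : s ^ (b + 1 / 2) = s ^ (3 / 2 : ℝ) * s ^ (b - 1) := by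
    rw [← Real.rpow_add hsp]; congr 1; ring
  rw [h5] at h4
  have h6 : 0 < c * s ^ (3 / 2 : ℝ) := by positivity
  refine le_of_mul_le_mul_left ?_ h6
  calc _ = c * (s ^ (3 / 2 : ℝ) * |v (s • q)|) := by ring
    _ ≤ _ := h4
    _ = _ := by field_simp

lemma PB_step2 {c R : ℝ} (hc : 0 < c) (hR : 1 ≤ R) (a b a' : ℝ) (hb : b + 1 / 2 < 0)
    (ha' : a' = a + (b + 1 / 2))
    (H : ∀ v, KCl c R v → PB R a b v) : ∀ v, KCl c R v → PB R a' (-3 / 2) v := by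
  intro v hv
  subst ha'
  obtain ⟨A, C, hA, hC, h⟩ := hv.core hc hR a b (a + (b + 1 / 2)) hb.ne
    (PB.cas (by linarith) (H v hv) fun i j => H _ ((hv.Z i j).Z i j))
  set β := b + 1 / 2 with hβ
  have hnb : 0 < -β := by linarith
  refine ⟨(A + C / (-β)) / c, by positivity, ?_⟩
  intro q hq0 hq s hs
  have hq1 : 1 ≤ q.1 := by nlinarith [sq_nonneg ‖q.2‖]
  have hs1 : 1 ≤ s := by nlinarith
  have hsp : 0 < s := by linarith
  have h1 := h q hq0 hq s hs
  have h2 : (s ^ β - (R * q.1) ^ β) / β ≤ q.1 ^ β / (-β) := by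
    rw [← neg_div_neg_eq]
    gcongr
    have : 0 ≤ s ^ β := by positivity
    have : (R * q.1) ^ β ≤ q.1 ^ β := Real.rpow_le_rpow_of_nonpos hq0 (by nlinarith) hb.le
    linarith
  have h4 : c * (s ^ (3 / 2 : ℝ) * |v (s • q)|) ≤ (A + C / (-β)) * q.1 ^ (a + β) := by
    calc _ ≤ _ := h1
      _ ≤ A * q.1 ^ (a + β) + C * q.1 ^ a * (q.1 ^ β / (-β)) := by
          gcongr
      _ = _ := by rw [Real.rpow_add hq0]; ring
  have h5 : s ^ (3 / 2 : ℝ) * s ^ (-3 / 2 : ℝ) = 1 := by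
    rw [← Real.rpow_add hsp]; norm_num
  have h6 : 0 < c * s ^ (3 / 2 : ℝ) := by positivity
  refine le_of_mul_le_mul_left ?_ h6
  calc _ = c * (s ^ (3 / 2 : ℝ) * |v (s • q)|) := by ring
    _ ≤ _ := h4
    _ = (A + C / (-β)) * q.1 ^ (a + β) * (s ^ (3 / 2 : ℝ) * s ^ (-3 / 2 : ℝ)) := by rw [h5, mul_one]
    _ = _ := by field_simp

lemma PB_final {c R : ℝ} (hc : 0 < c) (hR : 1 ≤ R) (H : ∀ v, KCl c R v → PB R 3 3 v) :
    ∀ v, KCl c R v → PB R (-3 / 2) (-3 / 2) v := by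
  have H1 := PB_step1 hc hR 3 3 2 (by norm_num) (by norm_num) H
  have H2 := PB_step1 hc hR 3 2 1 (by norm_num) (by norm_num) H1
  have H3 := PB_step1 hc hR 3 1 0 (by norm_num) (by norm_num) H2
  have H4 := PB_step1 hc hR 3 0 (-1) (by norm_num) (by norm_num) H3
  have H5 := PB_step2 hc hR 3 (-1) (5 / 2) (by norm_num) (by norm_num) H4
  have H6 := PB_step2 hc hR _ _ (3 / 2) (by norm_num) (by norm_num) H5
  have H7 := PB_step2 hc hR _ _ (1 / 2) (by norm_num) (by norm_num) H6
  have H8 := PB_step2 hc hR _ _ (-1 / 2) (by norm_num) (by norm_num) H7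
  exact PB_step2 hc hR _ _ (-3 / 2) (by norm_num) (by norm_num) H8

end

noncomputable section
open scoped BigOperators
open MeasureTheory

/-- vanishing outside the backward cone -/
def BCone (M : ℝ) (x1 : Sp) (G : Spt → ℝ) : Prop := ∀ p : Spt, M - p.1 < ‖p.2 - x1‖ → G p = 0

lemma BCone.D {M : ℝ} {x1 : Sp} {G : Spt → ℝ} (h : BCone M x1 G) (i : Fin 4) :
    BCone M x1 (kgD i G) := by
  intro p hp
  have o : IsOpen {p : Spt | M - p.1 < ‖p.2 - x1‖} :=
    isOpen_lt (continuous_const.sub continuous_fst) (continuous_snd.sub continuous_const).norm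
  have : G =ᶠ[nhds p] fun _ => 0 := by
    filter_upwards [o.mem_nhds hp] with q hq using h q hq
  simp [kgD, this.fderiv_eq]

lemma slice_cont {G : Spt → ℝ} (hG : Smo G) (t : ℝ) : Continuous fun x : Sp => G (t, x) :=
  hG.continuous.comp (by fun_prop)

lemma BCone.cs {M : ℝ} {x1 : Sp} {G : Spt → ℝ} (h : BCone M x1 G) (t : ℝ) :
    HasCompactSupport fun x : Sp => G (t, x) :=
  HasCompactSupport.intro (isCompact_closedBall x1 (M - t)) fun x hx => h (t, x) (by
    simpa [dist_eq_norm] using hx)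

lemma BCone.int {M : ℝ} {x1 : Sp} {G : Spt → ℝ} (h : BCone M x1 G) (hG : Smo G) (t : ℝ) :
    Integrable fun x : Sp => G (t, x) :=
  (slice_cont hG t).integrable_of_hasCompactSupport (h.cs t)

lemma BCone.div {M : ℝ} {x1 : Sp} {G : Spt → ℝ} (h : BCone M x1 G) (hG : Smo G) (t : ℝ)
    (a : Fin 4) (ha : a ≠ 0) : ∫ x : Sp, kgD a G (t, x) = 0 := by
  have hw : kgE a = (0, (kgE a).2) := by
    fin_cases a
    · simp at ha
    all_goals simp [kgE]
  have hf : ∀ x : Sp, HasFDerivAt (fun x : Sp => G (t, x))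
      ((fderiv ℝ G (t, x)).comp (ContinuousLinearMap.inr ℝ ℝ Sp)) x := fun x =>
    (hG.differentiable (t, x)).hasFDerivAt.comp x (hasFDerivAt_prodMk_right t x)
  have hd : ∀ x : Sp, kgD a G (t, x) = fderiv ℝ (fun x : Sp => G (t, x)) x (kgE a).2 := by
    intro x
    rw [(hf x).fderiv]
    conv_lhs => rw [kgD, hw]
    simp
  have := integral_mul_fderiv_eq_neg_fderiv_mul_of_integrable (μ := (volume : Measure Sp))
    (f := fun _ => (1 : ℝ)) (g := fun x : Sp => G (t, x)) (v := (kgE a).2)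
    (by simp) (by simpa [← hd] using (h.D a).int (kgD_smo hG a) t) (by simpa using h.int hG t)
    (by intros; fun_prop) (fun x _ => (hf x).differentiableAt)
  simpa [← hd] using this

lemma time_deriv {G : Spt → ℝ} (hG : Smo G) (t : ℝ) (x : Sp) :
    HasDerivAt (fun s : ℝ => G (s, x)) (kgD 0 G (t, x)) t := by
  have := (hG.differentiable (t, x)).hasFDerivAt.comp_hasDerivAt t
    ((hasDerivAt_id t).prodMk (hasDerivAt_const t x))
  exact this

lemma BCone.deriv {M : ℝ} {x1 : Sp} {G : Spt → ℝ} (h : BCone M x1 G) (hG : Smo G) (t : ℝ) :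
    HasDerivAt (fun s => ∫ x : Sp, G (s, x)) (∫ x : Sp, kgD 0 G (t, x)) t := by
  have hcomp : IsCompact (Set.Icc (t - 1) (t + 1) ×ˢ Metric.closedBall x1 (M - t + 1)) :=
    isCompact_Icc.prod (isCompact_closedBall _ _)
  obtain ⟨K, hK⟩ := hcomp.exists_bound_of_continuousOn (kgD_smo hG 0).continuous.continuousOn
  refine (hasDerivAt_integral_of_dominated_loc_of_deriv_le (s := Set.Icc (t - 1) (t + 1))
    (F := fun s x => G (s, x)) (F' := fun s x => kgD 0 G (s, x))
    (bound := (Metric.closedBall x1 (M - t + 1)).indicator fun _ => K)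
    (Icc_mem_nhds (by linarith) (by linarith)) ?_ ?_ ?_ ?_ ?_ ?_).2
  · exact Filter.Eventually.of_forall fun s => (slice_cont hG s).aestronglyMeasurable
  · exact h.int hG t
  · exact (slice_cont (kgD_smo hG 0) t).aestronglyMeasurable
  · refine Filter.Eventually.of_forall fun x s hs => ?_
    by_cases hx : x ∈ Metric.closedBall x1 (M - t + 1)
    · rw [Set.indicator_of_mem hx]
      exact hK (s, x) ⟨hs, hx⟩
    · rw [Set.indicator_of_notMem hx, h.D 0 (s, x)]
      · simp
      · simp only [Metric.mem_closedBall, dist_eq_norm, not_le] at hx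
        simp only
        linarith [hs.1]
  · exact (integrable_indicator_iff measurableSet_closedBall).2
      (integrableOn_const (isCompact_closedBall _ _).measure_lt_top.ne)
  · exact Filter.Eventually.of_forall fun x s _ => time_deriv hG s x

/-- energy density -/
def kgEn (c : ℝ) (v : Spt → ℝ) : Spt → ℝ :=
  kgD 0 v * kgD 0 v + kgD 1 v * kgD 1 v + kgD 2 v * kgD 2 v + kgD 3 v * kgD 3 v + c ^ 2 • (v * v)

lemma kgEn_smo (c : ℝ) {v : Spt → ℝ} (hv : Smo v) : Smo (kgEn c v) := by
  have s := fun i => (kgD_smo hv i).pmul (kgD_smo hv i)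
  exact ((((s 0).padd (s 1)).padd (s 2)).padd (s 3)).padd (Smo.psmul _ (hv.pmul hv))

lemma kgEn_ge (c : ℝ) (v : Spt → ℝ) (p : Spt) : c ^ 2 * v p ^ 2 ≤ kgEn c v p := by
  simp only [kgEn, Pi.add_apply, Pi.mul_apply, Pi.smul_apply, smul_eq_mul]
  nlinarith [mul_self_nonneg (kgD 0 v p), mul_self_nonneg (kgD 1 v p), mul_self_nonneg (kgD 2 v p),
    mul_self_nonneg (kgD 3 v p)]

/-- admissible phase -/
structure Adm (M : ℝ) (x1 : Sp) (σ : Spt → ℝ) : Prop where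
  smo : Smo σ
  d0 : ∀ p, kgD 0 σ p = -1
  da : ∀ p, kgD 1 σ p ^ 2 + kgD 2 σ p ^ 2 + kgD 3 σ p ^ 2 ≤ 1
  van : ∀ p : Spt, M - p.1 < ‖p.2 - x1‖ → σ p ≤ 0

/-- cutoff -/
def kgPhi (σ : Spt → ℝ) (p : Spt) : ℝ := Real.smoothTransition (σ p)

lemma kgPhi_smo {σ : Spt → ℝ} (h : Smo σ) : Smo (kgPhi σ) :=
  ContDiff.comp (Real.smoothTransition.contDiff (n := ⊤)) h

lemma kgPhi_D {σ : Spt → ℝ} (h : Smo σ) (i : Fin 4) (p : Spt) :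
    kgD i (kgPhi σ) p = deriv Real.smoothTransition (σ p) * kgD i σ p := by
  have hd : Differentiable ℝ Real.smoothTransition :=
    (Real.smoothTransition.contDiff (n := ⊤)).differentiable (by simp)
  have := (hd (σ p)).hasDerivAt.comp_hasFDerivAt p (h.differentiable p).hasFDerivAt
  unfold kgD
  rw [show kgPhi σ = Real.smoothTransition ∘ σ from rfl, this.fderiv]
  simp

lemma energy_antitone {c : ℝ} {v : Spt → ℝ} (hv : Smo v) (hkg : IsKG c v) {M : ℝ} {x1 : Sp}
    {σ : Spt → ℝ} (hσ : Adm M x1 σ) :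
    Antitone fun t => ∫ x : Sp, (kgPhi σ * kgEn c v) (t, x) := by
  have hφ := kgPhi_smo hσ.smo
  have hφ0 : BCone M x1 (kgPhi σ) := fun p hp =>
    Real.smoothTransition.zero_of_nonpos (hσ.van p hp)
  have hmul : ∀ f : Spt → ℝ, BCone M x1 (kgPhi σ * f) := fun f p hp => by
    simp [hφ0 p hp]
  have he := kgEn_smo c hv
  have hD := fun t => (hmul (kgEn c v)).deriv (hφ.pmul he) t
  refine antitone_of_deriv_nonpos (fun t => (hD t).differentiableAt) fun t => ?_
  rw [(hD t).deriv]
  -- flux terms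
  have s := kgD_smo hv
  set J : Fin 4 → Spt → ℝ := fun a => kgPhi σ * (kgD 0 v * kgD a v) with hJ
  have hJs : ∀ a, Smo (J a) := fun a => hφ.pmul ((s 0).pmul (s a))
  have hJ0 : ∀ a, BCone M x1 (J a) := fun a => hmul _
  have hJi : ∀ a, Integrable fun x : Sp => kgD a (J a) (t, x) := fun a =>
    ((hJ0 a).D a).int (kgD_smo (hJs a) a) t
  have hz : ∫ x : Sp, 2 * (kgD 1 (J 1) (t, x) + kgD 2 (J 2) (t, x) + kgD 3 (J 3) (t, x)) = 0 := by
    have h12 : Integrable fun x : Sp => kgD 1 (J 1) (t, x) + kgD 2 (J 2) (t, x) :=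
      (hJi 1).add (hJi 2)
    rw [integral_const_mul, integral_add h12 (hJi 3),
      integral_add (hJi 1) (hJi 2), (hJ0 1).div (hJs 1) t 1 (by simp),
      (hJ0 2).div (hJs 2) t 2 (by simp), (hJ0 3).div (hJs 3) t 3 (by simp)]
    simp
  rw [← hz]
  refine integral_mono (((hmul _).D 0).int (kgD_smo (hφ.pmul he) 0) t)
    ((((hJi 1).add (hJi 2)).add (hJi 3)).const_mul 2) fun x => ?_
  -- pointwise
  set p : Spt := (t, x)
  simp only
  have m := fun i => (kgD_smo hv i).pmul (kgD_smo hv i)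
  have d1 : kgD 0 (kgEn c v) p = 2 * (kgD 0 v p * kgD 0 (kgD 0 v) p + kgD 1 v p * kgD 0 (kgD 1 v) p
      + kgD 2 v p * kgD 0 (kgD 2 v) p + kgD 3 v p * kgD 0 (kgD 3 v) p + c ^ 2 * (v p * kgD 0 v p)) := by
    unfold kgEn
    rw [kgD_add ((((m 0).padd (m 1)).padd (m 2)).padd (m 3)) (Smo.psmul _ (hv.pmul hv)),
      kgD_add (((m 0).padd (m 1)).padd (m 2)) (m 3), kgD_add ((m 0).padd (m 1)) (m 2),
      kgD_add (m 0) (m 1), kgD_smul (hv.pmul hv), kgD_mul hv hv, kgD_mul (s 0) (s 0),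
      kgD_mul (s 1) (s 1), kgD_mul (s 2) (s 2), kgD_mul (s 3) (s 3)]
    simp only [Pi.add_apply, Pi.mul_apply, Pi.smul_apply, smul_eq_mul]
    ring
  have d2 : ∀ a, kgD a (J a) p = kgD a (kgPhi σ) p * (kgD 0 v p * kgD a v p)
      + kgPhi σ p * (kgD 0 (kgD a v) p * kgD a v p + kgD 0 v p * kgD a (kgD a v) p) := by
    intro a
    simp only [hJ]
    rw [kgD_mul hφ ((s 0).pmul (s a)), kgD_mul (s 0) (s a), kgD_comm hv a 0]
    simp only [Pi.add_apply, Pi.mul_apply]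
  rw [kgD_mul hφ he]
  simp only [Pi.add_apply, Pi.mul_apply, d1, d2, kgPhi_D hσ.smo, hσ.d0, hkg p]
  have hχ : 0 ≤ deriv Real.smoothTransition (σ p) := Real.smoothTransition.monotone.deriv_nonneg
  have hn := hσ.da p
  have hpt : 0 ≤ kgEn c v p + 2 * (kgD 0 v p * (kgD 1 σ p * kgD 1 v p + kgD 2 σ p * kgD 2 v p
      + kgD 3 σ p * kgD 3 v p)) := by
    simp only [kgEn, Pi.add_apply, Pi.mul_apply, Pi.smul_apply, smul_eq_mul]
    generalize kgD 0 v p = y0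
    generalize kgD 1 v p = y1
    generalize kgD 2 v p = y2
    generalize kgD 3 v p = y3
    generalize kgD 1 σ p = n1 at *
    generalize kgD 2 σ p = n2 at *
    generalize kgD 3 σ p = n3 at *
    have cs : (n1 * y1 + n2 * y2 + n3 * y3) ^ 2 ≤ y1 ^ 2 + y2 ^ 2 + y3 ^ 2 := by
      have : (n1 * y1 + n2 * y2 + n3 * y3) ^ 2 ≤ (n1 ^ 2 + n2 ^ 2 + n3 ^ 2) * (y1 ^ 2 + y2 ^ 2 + y3 ^ 2) := by
        nlinarith [sq_nonneg (n1 * y2 - n2 * y1), sq_nonneg (n1 * y3 - n3 * y1),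
          sq_nonneg (n2 * y3 - n3 * y2)]
      refine this.trans ?_
      exact mul_le_of_le_one_left (by positivity) hn
    have : 0 ≤ c ^ 2 * (v p * v p) := mul_nonneg (sq_nonneg c) (mul_self_nonneg _)
    nlinarith [sq_nonneg (y0 + (n1 * y1 + n2 * y2 + n3 * y3))]
  have := mul_nonneg hχ hpt
  linarith

/-- phase -/
def kgSig (δ M : ℝ) (x1 : Sp) (p : Spt) : ℝ := M - p.1 - √(δ ^ 2 + ‖p.2 - x1‖ ^ 2)

lemma kgSig_adm {δ : ℝ} (hδ : 0 < δ) (M : ℝ) (x1 : Sp) : Adm M x1 (kgSig δ M x1) := by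
  set r : Spt → ℝ := fun p => √(δ ^ 2 + ‖p.2 - x1‖ ^ 2) with hr
  have hpos : ∀ p : Spt, 0 < δ ^ 2 + ‖p.2 - x1‖ ^ 2 := fun p => by positivity
  have hrpos : ∀ p, 0 < r p := fun p => Real.sqrt_pos.2 (hpos p)
  have hrs : Smo r := by
    refine ContDiff.sqrt ?_ fun p => (hpos p).ne'
    exact contDiff_const.add ((contDiff_snd.sub contDiff_const).norm_sq ℝ)
  have hsig : kgSig δ M x1 = (fun _ => M) - kgX 0 - r := rfl
  have hcs : ∀ a : ℝ, Smo (fun _ => a) := fun a => contDiff_const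
  have hc0 : ∀ (a : ℝ) i, kgD i (fun _ => a) = 0 := fun a i => by
    funext p; simp [kgD]
  have hsm : Smo (kgSig δ M x1) := by
    rw [hsig]; exact ((hcs M).psub (kgX_smo 0)).psub hrs
  set y : Fin 4 → Spt → ℝ := fun i => kgX i - fun _ => kgX i (0, x1) with hy
  have hys : ∀ i, Smo (y i) := fun i => (kgX_smo i).psub (hcs _)
  have hrr : r * r = (fun _ => δ ^ 2) + y 1 * y 1 + y 2 * y 2 + y 3 * y 3 := by
    funext p
    have : r p * r p = _ := Real.mul_self_sqrt (hpos p).le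
    have h2 := EuclideanSpace.real_norm_sq_eq (p.2 - x1)
    simp only [Pi.mul_apply, this, h2, Fin.sum_univ_three, Pi.add_apply, hy, Pi.sub_apply, kgX]
    simp
    ring
  have hyD : ∀ i j, kgD i (y j) = fun _ => if i = j then 1 else 0 := fun i j => by
    rw [hy]; simp only; rw [kgD_sub (kgX_smo j) (hcs _), kgD_X, hc0]; simp
  have yy := fun i => (hys i).pmul (hys i)
  have hDr : ∀ i p, 2 * r p * kgD i r p = 2 * ((if i = 1 then y 1 p else 0)
      + (if i = 2 then y 2 p else 0) + if i = 3 then y 3 p else 0) := by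
    intro i p
    have := congrFun (congrArg (kgD i) hrr) p
    rw [kgD_mul hrs hrs, kgD_add (((hcs _).padd (yy 1)).padd (yy 2)) (yy 3),
      kgD_add ((hcs _).padd (yy 1)) (yy 2), kgD_add (hcs _) (yy 1), hc0, kgD_mul (hys 1) (hys 1),
      kgD_mul (hys 2) (hys 2), kgD_mul (hys 3) (hys 3), hyD, hyD, hyD] at this
    simp at this
    rw [show 2 * r p * kgD i r p = kgD i r p * r p + r p * kgD i r p by ring, this]
    split_ifs <;> ring
  have hDs : ∀ i p, kgD i (kgSig δ M x1) p = - (if i = 0 then 1 else 0) - kgD i r p := by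
    intro i p
    rw [hsig, kgD_sub ((hcs M).psub (kgX_smo 0)) hrs, kgD_sub (hcs M) (kgX_smo 0), hc0, kgD_X]
    simp
  refine ⟨hsm, ?_, ?_, ?_⟩
  · intro p
    have h0 := hDr 0 p
    simp [(hrpos p).ne'] at h0
    rw [hDs, h0]; simp
  · intro p
    have h1 := hDr 1 p
    have h2 := hDr 2 p
    have h3 := hDr 3 p
    simp at h1 h2 h3
    rw [hDs, hDs, hDs]
    simp
    have hh := congrFun hrr p
    simp only [Pi.mul_apply, Pi.add_apply] at hh
    have e : r p ^ 2 * (kgD 1 r p ^ 2 + kgD 2 r p ^ 2 + kgD 3 r p ^ 2) ≤ r p ^ 2 * 1 := by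
      have e1 : r p * kgD 1 r p = y 1 p := by linarith
      have e2 : r p * kgD 2 r p = y 2 p := by linarith
      have e3 : r p * kgD 3 r p = y 3 p := by linarith
      calc _ = (r p * kgD 1 r p) ^ 2 + (r p * kgD 2 r p) ^ 2 + (r p * kgD 3 r p) ^ 2 := by ring
        _ = y 1 p ^ 2 + y 2 p ^ 2 + y 3 p ^ 2 := by rw [e1, e2, e3]
        _ ≤ _ := by nlinarith [sq_nonneg δ]
    exact le_of_mul_le_mul_left e (pow_pos (hrpos p) 2)
  · intro p hp
    have : ‖p.2 - x1‖ ≤ r p := Real.le_sqrt_of_sq_le (by nlinarith [sq_nonneg δ])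
    simp only [kgSig]
    simp only [hr] at this
    linarith

end

noncomputable section
open scoped BigOperators
open MeasureTheory

lemma kgEn_nonneg (c : ℝ) (v : Spt → ℝ) (p : Spt) : 0 ≤ kgEn c v p :=
  le_trans (by positivity) (kgEn_ge c v p)

lemma finite_speed {c : ℝ} (hc : 0 < c) {v : Spt → ℝ} (hv : Smo v) (hkg : IsKG c v) (t0 R : ℝ)
    (h0 : ∀ x : Sp, R < ‖x‖ → kgEn c v (t0, x) = 0) (t1 : ℝ) (ht : t0 ≤ t1) (x1 : Sp)
    (hx : R + (t1 - t0) < ‖x1‖) : v (t1, x1) = 0 := by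
  set δ : ℝ := (‖x1‖ - R - (t1 - t0)) / 2 with hδ
  have hδ0 : 0 < δ := by linarith
  set M : ℝ := t1 + 2 * δ with hM
  have hadm := kgSig_adm hδ0 M x1
  have hE := energy_antitone hv hkg hadm ht
  have hE0 : ∫ x : Sp, (kgPhi (kgSig δ M x1) * kgEn c v) (t0, x) = 0 := by
    rw [← integral_zero Sp ℝ (μ := volume)]
    congr 1
    funext x
    by_cases hxx : R < ‖x‖
    · simp [h0 x hxx]
    · have : kgPhi (kgSig δ M x1) (t0, x) = 0 := by
        apply Real.smoothTransition.zero_of_nonpos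
        simp only [kgSig]
        have h1 : ‖x - x1‖ ≤ √(δ ^ 2 + ‖x - x1‖ ^ 2) :=
          Real.le_sqrt_of_sq_le (by nlinarith [sq_nonneg δ])
        have h2 : ‖x1‖ - ‖x‖ ≤ ‖x - x1‖ := by
          rw [← norm_neg (x - x1), neg_sub]; exact norm_sub_norm_le _ _
        linarith
      simp [this]
  simp only [hE0] at hE
  have hnn : ∀ x : Sp, 0 ≤ (kgPhi (kgSig δ M x1) * kgEn c v) (t1, x) := fun x =>
    mul_nonneg (Real.smoothTransition.nonneg _) (kgEn_nonneg _ _ _)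
  have hφ := kgPhi_smo hadm.smo
  have hcone : BCone M x1 (kgPhi (kgSig δ M x1) * kgEn c v) := fun p hp => by
    have : kgPhi (kgSig δ M x1) p = 0 := Real.smoothTransition.zero_of_nonpos (hadm.van p hp)
    simp [this]
  have hsm := hφ.pmul (kgEn_smo c hv)
  have hzero : ∫ x : Sp, (kgPhi (kgSig δ M x1) * kgEn c v) (t1, x) = 0 :=
    le_antisymm hE (integral_nonneg hnn)
  have hae := (integral_eq_zero_iff_of_nonneg hnn (hcone.int hsm t1)).1 hzero
  have hall := (Continuous.ae_eq_iff_eq volume (slice_cont hsm t1) continuous_const).1 hae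
  have hpt := congrFun hall x1
  simp only [Pi.mul_apply] at hpt
  have hpos : 0 < kgPhi (kgSig δ M x1) (t1, x1) := by
    apply Real.smoothTransition.pos_of_pos
    simp only [kgSig, sub_self, norm_zero]
    rw [show δ ^ 2 + (0 : ℝ) ^ 2 = δ ^ 2 by ring, Real.sqrt_sq hδ0.le]
    linarith
  have he : kgEn c v (t1, x1) = 0 := by
    rcases mul_eq_zero.1 hpt with h | h
    · exact absurd h hpos.ne'
    · exact h
  have := kgEn_ge c v (t1, x1)
  rw [he] at this
  have hc2 : 0 < c ^ 2 := by positivity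
  have : v (t1, x1) ^ 2 ≤ 0 := by
    by_contra hcon
    push Not at hcon
    nlinarith [mul_pos hc2 hcon]
  exact pow_eq_zero_iff (two_ne_zero) |>.1 (le_antisymm this (sq_nonneg _))

lemma KCl.cs {c R : ℝ} {v : Spt → ℝ} (h : KCl c R v) {t : ℝ} (ht : 2 * R < t) :
    HasCompactSupport fun x : Sp => v (t, x) :=
  HasCompactSupport.intro (isCompact_closedBall 0 (t - R)) fun x hx => h.van (t, x) ht (by
    simpa using hx)

lemma KCl.l2 {c R : ℝ} (hc : 0 < c) (hR : 1 ≤ R) {v : Spt → ℝ} (h : KCl c R v) :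
    ∃ B, 0 ≤ B ∧ ∀ t, 3 * R ≤ t → ∫ x : Sp, v (t, x) ^ 2 ≤ B := by
  have hc2 : 0 < c ^ 2 := by positivity
  have he := kgEn_smo c h.smo
  have hIntg0 : Integrable fun x : Sp => kgEn c v (3 * R, x) := by
    refine (slice_cont he _).integrable_of_hasCompactSupport ?_
    refine HasCompactSupport.intro (isCompact_closedBall 0 (3 * R - R)) fun x hx => ?_
    have h1 : 2 * R < ((3 * R, x) : Spt).1 := by simp only; linarith
    have h2 : ((3 * R, x) : Spt).1 - R < ‖((3 * R, x) : Spt).2‖ := by simpa using hx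
    simp [kgEn, h.van _ h1 h2, (h.D _).van _ h1 h2]
  refine ⟨(∫ x : Sp, kgEn c v (3 * R, x)) / c ^ 2,
    div_nonneg (integral_nonneg fun x => kgEn_nonneg _ _ _) hc2.le, fun t ht => ?_⟩
  set M : ℝ := t + √(1 ^ 2 + t ^ 2) + 1 with hM
  have hadm := kgSig_adm one_pos M (0 : Sp)
  have hφ := kgPhi_smo hadm.smo
  have hcone : BCone M 0 (kgPhi (kgSig 1 M 0) * kgEn c v) := fun p hp => by
    have : kgPhi (kgSig 1 M 0) p = 0 := Real.smoothTransition.zero_of_nonpos (hadm.van p hp)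
    simp [this]
  have hsm := hφ.pmul he
  have hE := energy_antitone h.smo h.kg hadm ht
  simp only at hE
  have h1 : ∫ x : Sp, (kgPhi (kgSig 1 M 0) * kgEn c v) (3 * R, x) ≤ ∫ x : Sp, kgEn c v (3 * R, x) :=
    integral_mono (hcone.int hsm _) hIntg0 fun x =>
      mul_le_of_le_one_left (kgEn_nonneg _ _ _) (Real.smoothTransition.le_one _)
  have hvint : Integrable fun x : Sp => c ^ 2 * v (t, x) ^ 2 := by
    have hcs : HasCompactSupport fun x : Sp => v (t, x) := h.cs (by linarith)
    refine Continuous.integrable_of_hasCompactSupport (((slice_cont h.smo t).pow 2).const_mul _) ?_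
    exact hcs.comp_left (g := fun y : ℝ => c ^ 2 * y ^ 2) (by simp)
  have h2 : ∫ x : Sp, c ^ 2 * v (t, x) ^ 2 ≤ ∫ x : Sp, (kgPhi (kgSig 1 M 0) * kgEn c v) (t, x) := by
    refine integral_mono hvint (hcone.int hsm _) fun x => ?_
    simp only [Pi.mul_apply]
    by_cases hx : ‖x‖ ≤ t
    · have : kgPhi (kgSig 1 M 0) (t, x) = 1 := by
        apply Real.smoothTransition.one_of_one_le
        simp only [kgSig, sub_zero]
        have : √(1 ^ 2 + ‖x‖ ^ 2) ≤ √(1 ^ 2 + t ^ 2) := by gcongr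
        linarith
      rw [this, one_mul]
      exact kgEn_ge c v (t, x)
    · push Not at hx
      have : v (t, x) = 0 := h.van (t, x) (by simp only; linarith) (by simp only; linarith)
      rw [this]
      simp only [ne_eq, OfNat.ofNat_ne_zero, not_false_eq_true, zero_pow, mul_zero]
      exact mul_nonneg (Real.smoothTransition.nonneg _) (kgEn_nonneg _ _ _)
  rw [integral_const_mul] at h2
  rw [le_div_iff₀ hc2]
  linarith

lemma line_bound {G : Spt → ℝ} (hG : Smo G) (r t : ℝ) (hr : ∀ x : Sp, r < ‖x‖ → G (t, x) = 0)
    (a : Fin 3) (x : Sp) (i : Fin 4) (hi : kgE i = (0, EuclideanSpace.single a 1)) :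
    ‖G (t, x)‖ₑ ≤ ∫⁻ s : ℝ, ‖kgD i G (t, x + EuclideanSpace.single a s)‖ₑ := by
  have hsing : ∀ s : ℝ, EuclideanSpace.single a s = s • (EuclideanSpace.single a 1 : Sp) := fun s => by
    ext j; simp
  set f : ℝ → ℝ := fun s => G (t, x + s • (EuclideanSpace.single a 1 : Sp)) with hf
  have hfs : ContDiff ℝ 1 f := by
    refine ContDiff.comp (hG.of_le (by exact WithTop.coe_le_coe.2 (le_top : (1 : ℕ∞) ≤ ⊤))) ?_
    fun_prop
  have hder : ∀ s, deriv f s = kgD i G (t, x + EuclideanSpace.single a s) := by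
    intro s
    rw [hsing]
    have h1 : HasDerivAt (fun s : ℝ => ((t, x + s • (EuclideanSpace.single a 1 : Sp)) : Spt))
        (0, EuclideanSpace.single a 1) s := by
      refine (hasDerivAt_const s t).prodMk ?_
      simpa using ((hasDerivAt_id s).smul_const (EuclideanSpace.single a 1 : Sp)).const_add x
    have := (hG.differentiable _).hasFDerivAt.comp_hasDerivAt s h1
    rw [kgD, hi]
    exact this.deriv
  have hcs : HasCompactSupport f := by
    refine HasCompactSupport.intro (isCompact_Icc (a := -(r + ‖x‖)) (b := r + ‖x‖)) fun s hs => ?_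
    apply hr
    have h1 : ‖s • (EuclideanSpace.single a 1 : Sp)‖ = |s| := by simp [norm_smul]
    have h2 : r + ‖x‖ < |s| := by
      rw [Set.mem_Icc, ← abs_le] at hs; exact not_le.1 hs
    have h3 : ‖s • (EuclideanSpace.single a 1 : Sp)‖ - ‖x‖ ≤ ‖x + s • (EuclideanSpace.single a 1 : Sp)‖ := by
      have := norm_sub_norm_le (s • (EuclideanSpace.single a 1 : Sp)) (-x)
      rwa [norm_neg, sub_neg_eq_add, add_comm (s • _) x] at this
    linarith
  have := hcs.enorm_le_lintegral_Ici_deriv hfs 0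
  have hf0 : f 0 = G (t, x) := by simp [hf]
  rw [hf0] at this
  refine this.trans ((setLIntegral_le_lintegral _ _).trans (le_of_eq ?_))
  simp only [hder]

lemma lintegral_sp (F : Sp → ENNReal) (hF : Measurable F) :
    ∫⁻ a : ℝ, ∫⁻ b : ℝ, ∫⁻ d : ℝ, F (EuclideanSpace.single 0 a + EuclideanSpace.single 1 b
      + EuclideanSpace.single 2 d) = ∫⁻ y : Sp, F y := by
  have hL : Measurable fun z : Fin 3 → ℝ => F (WithLp.toLp 2 z) :=
    hF.comp (PiLp.volume_preserving_toLp (Fin 3)).measurable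
  rw [← (PiLp.volume_preserving_toLp (Fin 3)).lintegral_comp hF]
  rw [← (volume_preserving_piFinSuccAbove (fun _ : Fin 3 => ℝ) 0).symm.lintegral_comp hL]
  rw [Measure.volume_eq_prod, lintegral_prod _ (by
    exact (hL.comp (MeasurableEquiv.measurable _)).aemeasurable)]
  refine lintegral_congr fun a => ?_
  have hL2 : Measurable fun z : Fin 2 → ℝ => F (WithLp.toLp 2
      ((MeasurableEquiv.piFinSuccAbove (fun _ : Fin 3 => ℝ) 0).symm (a, z))) :=
    hL.comp ((MeasurableEquiv.measurable _).comp measurable_prodMk_left)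
  rw [← (volume_preserving_finTwoArrow ℝ).symm.lintegral_comp hL2]
  rw [Measure.volume_eq_prod, lintegral_prod _ (by
    exact (hL2.comp (MeasurableEquiv.measurable _)).aemeasurable)]
  refine lintegral_congr fun b => lintegral_congr fun d => ?_
  congr 1
  ext j
  fin_cases j <;> simp [MeasurableEquiv.piFinSuccAbove, MeasurableEquiv.finTwoArrow]

set_option maxHeartbeats 2000000 in
lemma KCl.sup {c R : ℝ} (hc : 0 < c) (hR : 1 ≤ R) {v : Spt → ℝ} (h : KCl c R v) :
    ∃ B, 0 ≤ B ∧ ∀ p : Spt, 3 * R ≤ p.1 → |v p| ≤ B * p.1 ^ 3 := by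
  set w := kgD 3 (kgD 2 (kgD 1 v)) with hw
  have hwK : KCl c R w := ((h.D 1).D 2).D 3
  obtain ⟨B, hB0, hB⟩ := hwK.l2 hc hR
  set V : ℝ := (volume : Measure Sp).real (Metric.closedBall 0 1) with hV
  refine ⟨V + B, by positivity, ?_⟩
  rintro ⟨t, x⟩ ht
  simp only at ht ⊢
  have ht2 : 2 * R < t := by linarith
  have van : ∀ f, KCl c R f → ∀ x : Sp, t - R < ‖x‖ → f (t, x) = 0 := fun f hf x hx =>
    hf.van (t, x) ht2 hx
  have hcont := slice_cont hwK.smo t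
  have step : ‖v (t, x)‖ₑ ≤ ∫⁻ y : Sp, ‖w (t, y)‖ₑ := by
    calc ‖v (t, x)‖ₑ ≤ ∫⁻ a : ℝ, ‖kgD 1 v (t, x + EuclideanSpace.single 0 a)‖ₑ :=
          line_bound h.smo _ t (van v h) 0 x 1 rfl
      _ ≤ ∫⁻ a : ℝ, ∫⁻ b : ℝ, ‖kgD 2 (kgD 1 v) (t, x + EuclideanSpace.single 0 a
            + EuclideanSpace.single 1 b)‖ₑ :=
          lintegral_mono fun a => line_bound (h.D 1).smo _ t (van _ (h.D 1)) 1 _ 2 rfl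
      _ ≤ ∫⁻ a : ℝ, ∫⁻ b : ℝ, ∫⁻ d : ℝ, ‖w (t, x + EuclideanSpace.single 0 a
            + EuclideanSpace.single 1 b + EuclideanSpace.single 2 d)‖ₑ :=
          lintegral_mono fun a => lintegral_mono fun b =>
            line_bound ((h.D 1).D 2).smo _ t (van _ ((h.D 1).D 2)) 2 _ 3 rfl
      _ = ∫⁻ y : Sp, ‖w (t, x + y)‖ₑ := by
          rw [← lintegral_sp (fun y => ‖w (t, x + y)‖ₑ)
            (by exact (hcont.comp (continuous_const.add continuous_id)).enorm.measurable)]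
          simp only [add_assoc]
      _ = _ := lintegral_add_left_eq_self (fun y : Sp => ‖w (t, y)‖ₑ) x
  have hcs : HasCompactSupport fun x : Sp => w (t, x) := hwK.cs ht2
  have hIntg : Integrable fun y : Sp => w (t, y) := hcont.integrable_of_hasCompactSupport hcs
  have hIntg2 : Integrable fun y : Sp => w (t, y) ^ 2 :=
    Continuous.integrable_of_hasCompactSupport (f := fun y : Sp => w (t, y) ^ 2)
      (by exact hcont.pow 2) (by exact hcs.comp_left (g := fun y : ℝ => y ^ 2) (by simp))
  have step2 : |v (t, x)| ≤ ∫ y : Sp, |w (t, y)| := by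
    rw [← ofReal_integral_norm_eq_lintegral_enorm hIntg, ← ofReal_norm_eq_enorm] at step
    exact (ENNReal.ofReal_le_ofReal_iff (integral_nonneg fun _ => norm_nonneg _)).1 step
  have hball : Integrable ((Metric.closedBall (0 : Sp) t).indicator fun _ => (1 : ℝ)) :=
    (integrable_indicator_iff measurableSet_closedBall).2
      (integrableOn_const (isCompact_closedBall _ _).measure_lt_top.ne)
  have step3 : ∫ y : Sp, |w (t, y)| ≤
      ∫ y : Sp, ((Metric.closedBall (0 : Sp) t).indicator (fun _ => (1 : ℝ)) y + w (t, y) ^ 2) := by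
    refine integral_mono hIntg.abs (hball.add hIntg2) fun y => ?_
    simp only
    by_cases hy : y ∈ Metric.closedBall (0 : Sp) t
    · rw [Set.indicator_of_mem hy]
      nlinarith [sq_abs (w (t, y)), sq_nonneg (|w (t, y)| - 1)]
    · rw [van w hwK y (by simp at hy; linarith)]
      simp [hy]
  rw [integral_add hball hIntg2, integral_indicator measurableSet_closedBall] at step3
  have hvol : ∫ _y in Metric.closedBall (0 : Sp) t, (1 : ℝ) = t ^ 3 * V := by
    rw [setIntegral_const, smul_eq_mul, mul_one, hV, Measure.real,
      Measure.addHaar_closedBall_eq_addHaar_ball, Measure.real,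
      Measure.addHaar_closedBall_eq_addHaar_ball, Measure.addHaar_ball _ _ (by linarith)]
    rw [ENNReal.toReal_mul, ENNReal.toReal_ofReal (pow_nonneg (by linarith) _)]
    simp
  rw [hvol] at step3
  have := hB t ht
  have ht1 : 1 ≤ t ^ 3 := one_le_pow₀ (by linarith)
  nlinarith

lemma KCl.pb {c R : ℝ} (hc : 0 < c) (hR : 1 ≤ R) {v : Spt → ℝ} (h : KCl c R v) : PB R 3 3 v := by
  obtain ⟨B, hB0, hB⟩ := h.sup hc hR
  have hcomp : IsCompact (Metric.closedBall (0 : Spt) (3 * R)) := isCompact_closedBall _ _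
  obtain ⟨M1, hM1⟩ := hcomp.exists_bound_of_continuousOn h.smo.continuous.continuousOn
  have hM1' : 0 ≤ M1 := (norm_nonneg _).trans (hM1 0 (by simp; linarith))
  refine ⟨M1 + B, by positivity, ?_⟩
  intro q hq0 hq s hs
  have hq1 : 1 ≤ q.1 := by nlinarith [sq_nonneg ‖q.2‖]
  have hs1 : 1 ≤ s := by nlinarith
  have e3 : ∀ y : ℝ, y ^ (3 : ℝ) = y ^ 3 := fun y => by
    rw [show (3 : ℝ) = ((3 : ℕ) : ℝ) by norm_num, Real.rpow_natCast]
  have hp : (s • q).1 = s * q.1 := rfl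
  rw [e3, e3, show (M1 + B) * q.1 ^ 3 * s ^ 3 = (M1 + B) * (s * q.1) ^ 3 by ring]
  have h1 : 1 ≤ (s * q.1) ^ 3 := one_le_pow₀ (by nlinarith)
  by_cases hcase : 3 * R ≤ s * q.1
  · have := hB (s • q) hcase
    rw [hp] at this
    refine this.trans ?_
    gcongr
    linarith
  · push Not at hcase
    have hnq : ‖q.2‖ ≤ q.1 := by nlinarith [norm_nonneg q.2]
    have hmem : s • q ∈ Metric.closedBall (0 : Spt) (3 * R) := by
      rw [mem_closedBall_zero_iff, norm_smul, Real.norm_eq_abs, abs_of_pos (by linarith)]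
      have : ‖q‖ ≤ q.1 := by
        rw [Prod.norm_def]; refine max_le ?_ hnq
        rw [Real.norm_eq_abs, abs_of_pos hq0]
      nlinarith
    have := hM1 _ hmem
    rw [Real.norm_eq_abs] at this
    nlinarith

lemma kgD_shift (v : Spt → ℝ) (a : Spt) (i : Fin 4) :
    kgD i (fun p => v (p - a)) = fun p => kgD i v (p - a) := by
  funext p
  simp only [kgD]
  rw [fderiv_comp_sub]

lemma slice_D {G : Spt → ℝ} (hG : Smo G) (t : ℝ) (x : Sp) (a : Fin 3) :
    fderiv ℝ G (t, x) (0, EuclideanSpace.single a 1)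
      = fderiv ℝ (fun x : Sp => G (t, x)) x (EuclideanSpace.single a 1) := by
  have hf : HasFDerivAt (fun x : Sp => G (t, x))
      ((fderiv ℝ G (t, x)).comp (ContinuousLinearMap.inr ℝ ℝ Sp)) x :=
    (hG.differentiable (t, x)).hasFDerivAt.comp x (hasFDerivAt_prodMk_right t x)
  rw [hf.fderiv]
  simp

theorem klein_gordon_decay
    (c : ℝ) (hc : 0 < c)
    (u₀ u₁ : Sp → ℝ) (h₀ : ContDiff ℝ (⊤ : ℕ∞) u₀) (h₁ : ContDiff ℝ (⊤ : ℕ∞) u₁)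
    (hc₀ : HasCompactSupport u₀) (hc₁ : HasCompactSupport u₁)
    (u : Spt → ℝ) (hu : ContDiff ℝ (⊤ : ℕ∞) u)
    (hKG : ∀ p : Spt, dt (dt u) p - (∑ a : Fin 3, dx a (dx a u) p) + c ^ 2 * u p = 0)
    (hinit₀ : ∀ x : Sp, u (0, x) = u₀ x)
    (hinit₁ : ∀ x : Sp, dt u (0, x) = u₁ x) :
    ∃ C : ℝ, ∀ t : ℝ, 0 ≤ t → ∀ x : Sp, |u (t, x)| ≤ C * (1 + t) ^ (-(3 : ℝ) / 2) := by
  have hkg : IsKG c u := by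
    intro p
    have := hKG p
    rw [Fin.sum_univ_three] at this
    change kgD 0 (kgD 0 u) p - (kgD 1 (kgD 1 u) p + kgD 2 (kgD 2 u) p + kgD 3 (kgD 3 u) p)
      + c ^ 2 * u p = 0 at this
    linarith
  obtain ⟨R0, hR0⟩ := hc₀.isCompact.isBounded.subset_closedBall (0 : Sp)
  obtain ⟨R1, hR1⟩ := hc₁.isCompact.isBounded.subset_closedBall (0 : Sp)
  set R : ℝ := max 1 (max R0 R1) with hRdef
  have hR : 1 ≤ R := le_max_left _ _
  have hRR0 : R0 ≤ R := (le_max_left _ _).trans (le_max_right _ _)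
  have hRR1 : R1 ≤ R := (le_max_right _ _).trans (le_max_right _ _)
  have v0 : ∀ x : Sp, R < ‖x‖ → x ∉ tsupport u₀ := fun x hx hx' => by
    have := hR0 hx'
    rw [mem_closedBall_zero_iff] at this
    linarith
  have v1 : ∀ x : Sp, R < ‖x‖ → x ∉ tsupport u₁ := fun x hx hx' => by
    have := hR1 hx'
    rw [mem_closedBall_zero_iff] at this
    linarith
  have hen : ∀ x : Sp, R < ‖x‖ → kgEn c u (0, x) = 0 := by
    intro x hx
    have hfun : (fun x : Sp => u (0, x)) = u₀ := funext hinit₀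
    have hd : ∀ a : Fin 3, fderiv ℝ u (0, x) (0, EuclideanSpace.single a 1) = 0 := by
      intro a
      rw [slice_D hu, hfun, ((notMem_tsupport_iff_eventuallyEq).1 (v0 x hx)).fderiv_eq]
      simp
    have e0 : kgD 0 u (0, x) = 0 := by
      have : dt u (0, x) = 0 := by rw [hinit₁]; exact image_eq_zero_of_notMem_tsupport (v1 x hx)
      exact this
    have e1 : kgD 1 u (0, x) = 0 := hd 0
    have e2 : kgD 2 u (0, x) = 0 := hd 1
    have e3 : kgD 3 u (0, x) = 0 := hd 2
    have e4 : u (0, x) = 0 := by rw [hinit₀]; exact image_eq_zero_of_notMem_tsupport (v0 x hx)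
    simp [kgEn, e0, e1, e2, e3, e4]
  have hfs : ∀ (t : ℝ) (x : Sp), 0 ≤ t → R + t < ‖x‖ → u (t, x) = 0 := fun t x ht hx =>
    finite_speed hc hu hkg 0 R hen t ht x (by simpa using hx)
  set w : Spt → ℝ := fun p => u (p - (2 * R, 0)) with hw
  have hwK : KCl c R w := by
    refine ⟨ContDiff.comp hu (contDiff_id.sub contDiff_const), ?_, ?_⟩
    · intro p
      simp only [hw, kgD_shift]
      exact hkg _
    · rintro ⟨t, x⟩ h1 h2
      simp only [hw, Prod.mk_sub_mk, sub_zero] at *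
      exact hfs _ _ (by linarith) (by linarith)
  obtain ⟨C, hC0, hC⟩ := PB_final hc hR (fun v hv => hv.pb hc hR) w hwK
  refine ⟨C, fun t ht x => ?_⟩
  by_cases hx : R + t < ‖x‖
  · rw [hfs t x ht hx, abs_zero]
    have : 0 ≤ 1 + t := by linarith
    positivity
  · push Not at hx
    set T : ℝ := t + 2 * R with hT
    have hTp : 0 < T := by linarith
    have hxT : ‖x‖ ≤ T - R := by linarith
    have hρ2 : R * T ≤ T ^ 2 - ‖x‖ ^ 2 := by nlinarith [norm_nonneg x]
    have hpos : 0 < T ^ 2 - ‖x‖ ^ 2 := lt_of_lt_of_le (by positivity) hρ2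
    set ρ : ℝ := √(T ^ 2 - ‖x‖ ^ 2) with hρ
    have hρ0 : 0 < ρ := Real.sqrt_pos.2 hpos
    have hρsq : ρ ^ 2 = T ^ 2 - ‖x‖ ^ 2 := Real.sq_sqrt hpos.le
    have key := hC (ρ⁻¹ • ((T, x) : Spt)) (by simp only [Prod.smul_mk, smul_eq_mul]; positivity)
      (by
        simp only [Prod.smul_mk, smul_eq_mul, norm_smul, norm_inv, Real.norm_eq_abs,
          abs_of_pos hρ0]
        field_simp
        linarith) ρ (by
        simp only [Prod.smul_mk, smul_eq_mul]
        rw [← mul_assoc, mul_comm R, mul_assoc, inv_mul_le_iff₀ hρ0]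
        nlinarith)
    rw [smul_inv_smul₀ hρ0.ne'] at key
    have hwu : w (T, x) = u (t, x) := by simp [hw, hT]
    rw [hwu] at key
    refine key.trans ?_
    simp only [Prod.smul_mk, smul_eq_mul]
    rw [mul_assoc, ← Real.mul_rpow (by positivity) hρ0.le]
    have e1 : ρ⁻¹ * T * ρ = T := by field_simp
    rw [e1]
    refine mul_le_mul_of_nonneg_left ?_ hC0
    exact Real.rpow_le_rpow_of_nonpos (by linarith) (by linarith) (by norm_num)
end
end
end
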